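/- Let G be a bridgeless simple graph of order n, minimum degree δ ≥ 4, and girth g. Let h(δ,g) = 1 + δ + Σ_{i=1}^{⌊(g-1)/2⌋-1} δ(δ-3)^i. Then for every real ε > 0, setting L = ⌈(g-1)/ε⌉, the oriented diameter of G satisfies diam→(G) ≤ (2g+ε)·n/h(δ,g) + 4·binomial(Lg+1, 2). -/

import Mathlib

open SimpleGraph

/-- `D` is an orientation of the simple graph `G`: every arc of `D` lies along an edge of `G`,
and every edge of `G` receives exactly one of the two possible directions. -/
def IsOrientation {V : Type*} (G : SimpleGraph V) (D : V → V → Prop) : Prop :=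
  (∀ u v, D u v → G.Adj u v) ∧ ∀ u v, G.Adj u v → (D u v ↔ ¬ D v u)

/-- There is a directed walk of length `n` from `u` to `v` in the digraph with arc relation `D`. -/
def DiReach {V : Type*} (D : V → V → Prop) (u v : V) (n : ℕ) : Prop :=
  ∃ f : Fin (n + 1) → V, f 0 = u ∧ f (Fin.last n) = v ∧
    ∀ i : Fin n, D (f i.castSucc) (f i.succ)

/-- A graph is bridgeless if it is connected and none of its edges is a bridge. -/
def Bridgeless {V : Type*} (G : SimpleGraph V) : Prop :=
  G.Connected ∧ ∀ e : Sym2 V, ¬ G.IsBridge e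

/-- `hPoly δ g = 1 + δ + ∑_{i=1}^{⌊(g-1)/2⌋ - 1} δ (δ - 3)^i`. -/
def hPoly (δ g : ℕ) : ℕ :=
  1 + δ + ∑ i ∈ Finset.Icc 1 ((g - 1) / 2 - 1), δ * (δ - 3) ^ i

section Girth

variable {V : Type*} {G : SimpleGraph V}

/-- Two paths with common endpoints whose total length is below the girth coincide. -/
lemma path_unique_of_length_lt_egirth {u v : V} {p q : G.Walk u v} (hp : p.IsPath)
    (hq : q.IsPath) (h : ((p.length + q.length : ℕ) : ℕ∞) < G.egirth) : p = q := by
  classical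
  set S : SimpleGraph V := SimpleGraph.fromEdgeSet {e | e ∈ p.edges ++ q.edges} with hS
  have hpS : ∀ e ∈ p.edges, e ∈ S.edgeSet := fun e he => by
    rw [hS, SimpleGraph.edgeSet_fromEdgeSet]
    exact ⟨List.mem_append_left _ he, G.not_isDiag_of_mem_edgeSet (p.edges_subset_edgeSet he)⟩
  have hqS : ∀ e ∈ q.edges, e ∈ S.edgeSet := fun e he => by
    rw [hS, SimpleGraph.edgeSet_fromEdgeSet]
    exact ⟨List.mem_append_right _ he, G.not_isDiag_of_mem_edgeSet (q.edges_subset_edgeSet he)⟩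
  have hSG : ∀ e ∈ S.edgeSet, e ∈ G.edgeSet ∧ e ∈ p.edges ++ q.edges := fun e he => by
    rw [hS, SimpleGraph.edgeSet_fromEdgeSet] at he
    refine ⟨?_, he.1⟩
    rcases List.mem_append.1 he.1 with h1 | h1
    · exact p.edges_subset_edgeSet h1
    · exact q.edges_subset_edgeSet h1
  by_cases hac : S.IsAcyclic
  · have := (hac.subsingleton_path u v).elim ⟨p.transfer S hpS, hp.transfer hpS⟩
      ⟨q.transfer S hqS, hq.transfer hqS⟩
    have h2 := congrArg (fun r : S.Path u v => r.1.support) this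
    simp only [Walk.support_transfer] at h2
    exact Walk.ext_support h2
  · exfalso
    simp only [IsAcyclic, not_forall, not_not] at hac
    obtain ⟨a, c, hc⟩ := hac
    have hcG : ∀ e ∈ c.edges, e ∈ G.edgeSet := fun e he => (hSG e (c.edges_subset_edgeSet he)).1
    have h1 := egirth_le_length (hc.transfer hcG)
    have h2 : c.length ≤ p.length + q.length := by
      rw [← c.length_edges, ← p.length_edges, ← q.length_edges, ← List.length_append]
      exact (hc.edges_nodup.subperm
        fun e he => (hSG e (c.edges_subset_edgeSet he)).2).length_le
    rw [Walk.length_transfer] at h1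
    exact absurd (h1.trans (by exact_mod_cast h2)) (not_le.2 h)

lemma exists_geodesic_cons (hG : G.Connected) {b w x : V} (hwx : G.Adj w x)
    (h : G.dist w b = G.dist x b + 1) :
    ∃ p : G.Walk w b, p.IsPath ∧ p.length = G.dist w b ∧ p.snd = x := by
  obtain ⟨q, hq⟩ := hG.exists_walk_length_eq_dist x b
  have hl : (Walk.cons hwx q).length = G.dist w b := by simp [hq, h]
  exact ⟨Walk.cons hwx q, Walk.isPath_of_length_eq_dist _ hl, hl, by simp⟩

/-- Below half the girth, the neighbour closer to a base point is unique. -/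
lemma closer_neighbor_unique (hG : G.Connected) {b w x y : V} (hwx : G.Adj w x) (hwy : G.Adj w y)
    (hx : G.dist w b = G.dist x b + 1) (hy : G.dist w b = G.dist y b + 1)
    (hg : ((2 * G.dist w b : ℕ) : ℕ∞) < G.egirth) : x = y := by
  obtain ⟨p, hp, hpl, rfl⟩ := exists_geodesic_cons hG hwx hx
  obtain ⟨q, hq, hql, rfl⟩ := exists_geodesic_cons hG hwy hy
  rw [path_unique_of_length_lt_egirth hp hq (by rw [hpl, hql, ← two_mul]; exact hg)]

/-- Below half the girth, adjacent vertices have different distances to a base point. -/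
lemma dist_ne_of_adj (hG : G.Connected) {b w x : V} (hwx : G.Adj w x)
    (hg : ((2 * G.dist w b + 1 : ℕ) : ℕ∞) < G.egirth) : G.dist w b ≠ G.dist x b := by
  intro h
  obtain ⟨p, hp, hpl⟩ := hG.exists_path_of_dist w b
  obtain ⟨q, hq, hql⟩ := hG.exists_path_of_dist x b
  classical
  have hw : w ∉ q.support := by
    intro hw
    have h1 := G.dist_le (q.dropUntil w hw)
    have h2 := congrArg Walk.length (q.take_spec hw)
    have h3 : 1 ≤ (q.takeUntil w hw).length := by
      by_contra h0
      exact hwx.ne (Walk.eq_of_length_eq_zero (p := q.takeUntil w hw) (by omega)).symm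
    rw [Walk.length_append] at h2
    omega
  have := path_unique_of_length_lt_egirth hp (hq.cons (h := hwx) hw) (by
    rw [Walk.length_cons, hpl, hql]
    have h4 : G.dist w b + (G.dist x b + 1) = 2 * G.dist w b + 1 := by omega
    rw [h4]; exact hg)
  have h5 := congrArg Walk.length this
  rw [Walk.length_cons] at h5
  omega

/-- The distance to a base point changes by exactly one along an edge near the base point. -/
lemma dist_adj_cases (hG : G.Connected) {b w x : V} (hwx : G.Adj w x)
    (hg : ((2 * G.dist w b + 1 : ℕ) : ℕ∞) < G.egirth) :
    G.dist w b = G.dist x b + 1 ∨ G.dist x b = G.dist w b + 1 := by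
  have h1 := dist_ne_of_adj hG hwx hg
  have h2 : G.dist w b ≤ G.dist w x + G.dist x b := hG.dist_triangle
  have h3 : G.dist x b ≤ G.dist x w + G.dist w b := hG.dist_triangle
  have h4 := dist_eq_one_iff_adj.2 hwx
  have h5 := dist_eq_one_iff_adj.2 hwx.symm
  omega

end Girth

section Steps

variable {V : Type*} {R S : V → V → Prop}

/-- `Steps R n x y`: there is an `R`-walk of length `n` from `x` to `y`. -/
def Steps (R : V → V → Prop) : ℕ → V → V → Prop
  | 0, x, y => x = y
  | n + 1, x, y => ∃ z, R x z ∧ Steps R n z y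

lemma Steps.single {x y : V} (h : R x y) : Steps R 1 x y := ⟨y, h, rfl⟩

lemma Steps.trans {m n : ℕ} {x y z : V} (h : Steps R m x y) (h' : Steps R n y z) :
    Steps R (m + n) x z := by
  induction m generalizing x with
  | zero => cases h; simpa using h'
  | succ m ih =>
    obtain ⟨w, hw, hwy⟩ := h
    rw [Nat.add_right_comm]
    exact ⟨w, hw, ih hwy⟩

lemma Steps.snoc {n : ℕ} {x y z : V} (h : Steps R n x y) (h' : R y z) : Steps R (n + 1) x z :=
  h.trans (.single h')

lemma Steps.flip {n : ℕ} {x y : V} (h : Steps R n x y) : Steps (fun a b => R b a) n y x := by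
  induction n generalizing x with
  | zero => exact Eq.symm h
  | succ n ih =>
    obtain ⟨w, hw, hwy⟩ := h
    exact (ih hwy).snoc hw

lemma Steps.mono {n : ℕ} {x y : V} (h : Steps R n x y) (hRS : ∀ a b, R a b → S a b) :
    Steps S n x y := by
  induction n generalizing x with
  | zero => exact h
  | succ n ih =>
    obtain ⟨w, hw, hwy⟩ := h
    exact ⟨w, hRS _ _ hw, ih hwy⟩

lemma steps_of_ascending {q : ℕ → V} {a b : ℕ} (hab : a ≤ b)
    (h : ∀ j, a ≤ j → j < b → R (q j) (q (j + 1))) : Steps R (b - a) (q a) (q b) := by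
  obtain ⟨n, rfl⟩ := Nat.exists_eq_add_of_le hab
  rw [Nat.add_sub_cancel_left]
  clear hab
  induction n with
  | zero => rfl
  | succ n ih => exact (ih fun j h1 h2 => h j h1 (by omega)).snoc (h _ (by omega) (by omega))

lemma steps_of_descending {q : ℕ → V} {a b : ℕ} (hab : a ≤ b)
    (h : ∀ j, a ≤ j → j < b → R (q (j + 1)) (q j)) : Steps R (b - a) (q b) (q a) :=
  (steps_of_ascending (R := fun x y => R y x) hab h).flip

lemma Steps.diReach {n : ℕ} {x y : V} (h : Steps R n x y) : DiReach R x y n := by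
  induction n generalizing x with
  | zero => cases h; exact ⟨fun _ => y, rfl, rfl, fun i => i.elim0⟩
  | succ n ih =>
    obtain ⟨w, hw, hwy⟩ := h
    obtain ⟨f, hf0, hfn, hf⟩ := ih hwy
    refine ⟨Fin.cons x f, rfl, ?_, ?_⟩
    · rw [← Fin.succ_last, Fin.cons_succ, hfn]
    · intro i
      refine Fin.cases ?_ (fun i => ?_) i
      · simpa [hf0] using hw
      · rw [Fin.castSucc_succ, Fin.cons_succ, Fin.cons_succ]
        exact hf i

lemma steps_of_walk {G : SimpleGraph V} {x y : V} (p : G.Walk x y) :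
    Steps G.Adj p.length x y := by
  induction p with
  | nil => rfl
  | cons h p ih => exact ⟨_, h, ih⟩

lemma Steps.exists_walk {G : SimpleGraph V} {n : ℕ} {x y : V} (h : Steps G.Adj n x y) :
    ∃ p : G.Walk x y, p.length = n := by
  induction n generalizing x with
  | zero => cases h; exact ⟨.nil, rfl⟩
  | succ n ih =>
    obtain ⟨w, hw, hwy⟩ := h
    obtain ⟨p, rfl⟩ := ih hwy
    exact ⟨.cons hw p, rfl⟩

lemma Steps.dist_le {G : SimpleGraph V} {n : ℕ} {x y : V} (h : Steps G.Adj n x y) :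
    G.dist x y ≤ n := by
  obtain ⟨p, rfl⟩ := h.exists_walk
  exact G.dist_le p

/-- Some `R`-walk leads from `x` into `H`. -/
def Reaches (R : V → V → Prop) (H : Finset V) (x : V) : Prop :=
  ∃ n, ∃ h ∈ H, Steps R n x h

/-- The length of a shortest `R`-walk from `x` into `H`. -/
noncomputable def distTo (R : V → V → Prop) (H : Finset V) (x : V) : ℕ :=
  sInf {n | ∃ h ∈ H, Steps R n x h}

variable {H K : Finset V}

lemma distTo_le {n : ℕ} {x h : V} (hs : Steps R n x h) (hh : h ∈ H) : distTo R H x ≤ n :=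
  Nat.sInf_le ⟨h, hh, hs⟩

lemma Reaches.exists_steps {x : V} (h : Reaches R H x) :
    ∃ y ∈ H, Steps R (distTo R H x) x y :=
  Nat.sInf_mem (s := {n | ∃ h ∈ H, Steps R n x h}) h

lemma Reaches.of_steps {n : ℕ} {x y : V} (hs : Steps R n x y) (h : Reaches R H y) :
    Reaches R H x := by
  obtain ⟨m, z, hz, hm⟩ := h
  exact ⟨_, z, hz, hs.trans hm⟩

lemma Reaches.distTo_le_add {n : ℕ} {x y : V} (h : Reaches R H y) (hs : Steps R n x y) :
    distTo R H x ≤ n + distTo R H y := by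
  obtain ⟨z, hz, hm⟩ := h.exists_steps
  exact distTo_le (hs.trans hm) hz

lemma distTo_eq_zero_of_mem {x : V} (h : x ∈ H) : distTo R H x = 0 :=
  Nat.le_zero.1 (distTo_le (R := R) (n := 0) rfl h)

lemma Reaches.mem_of_distTo_eq_zero {x : V} (h : Reaches R H x) (h0 : distTo R H x = 0) :
    x ∈ H := by
  obtain ⟨z, hz, hm⟩ := h.exists_steps
  rw [h0] at hm
  cases hm
  exact hz

/-- A shortest walk into `H`, indexed by the distance to `H`. -/
lemma Reaches.exists_geodesic {x : V} (h : Reaches R H x) :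
    ∃ q : ℕ → V, q 0 ∈ H ∧ q (distTo R H x) = x ∧
      (∀ j < distTo R H x, R (q (j + 1)) (q j)) ∧ ∀ j ≤ distTo R H x, distTo R H (q j) = j := by
  generalize hn : distTo R H x = n
  induction n generalizing x with
  | zero =>
    exact ⟨fun _ => x, h.mem_of_distTo_eq_zero hn, rfl, by simp, fun j hj => by
      rw [Nat.le_zero.1 hj, hn]⟩
  | succ n ih =>
    obtain ⟨y, hy, hs⟩ := h.exists_steps
    rw [hn] at hs
    obtain ⟨z, hz, hzy⟩ := hs
    have hr : Reaches R H z := ⟨_, y, hy, hzy⟩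
    have h1 := distTo_le hzy hy
    have h2 := hr.distTo_le_add (.single hz)
    obtain ⟨q, hq0, hqn, hq, hqd⟩ := ih hr (by omega)
    refine ⟨fun j => if j ≤ n then q j else x, by simpa using hq0, by simp, ?_, ?_⟩
    · intro j hj
      rcases Nat.lt_succ_iff_lt_or_eq.1 hj with h3 | rfl
      · simpa [h3.le, Nat.succ_le_of_lt h3] using hq j h3
      · simpa [hqn] using hz
    · intro j hj
      by_cases h3 : j ≤ n
      · simpa [h3] using hqd j h3
      · obtain rfl : j = n + 1 := by omega
        simpa using hn

/-- An arc relation supported on `H` needs fewer than `#H` steps. -/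
lemma Steps.exists_lt_card {n : ℕ} {x y : V} (h : Steps R n x y)
    (hR : ∀ a b, R a b → a ∈ H ∧ b ∈ H) (hy : y ∈ H) :
    ∃ m, m + 1 ≤ H.card ∧ Steps R m x y := by
  have hr : Reaches R {y} x := ⟨n, y, by simp, h⟩
  obtain ⟨q, hq0, hqn, hq, hqd⟩ := hr.exists_geodesic
  rw [Finset.mem_singleton] at hq0
  refine ⟨distTo R {y} x, ?_, ?_⟩
  · have : (Finset.range (distTo R {y} x + 1)).card ≤ H.card := by
      refine Finset.card_le_card_of_injOn q ?_ ?_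
      · intro j hj
        rcases j with _ | j
        · simpa [hq0] using hy
        · simp only [Finset.coe_range, Set.mem_Iio, Nat.lt_succ_iff] at hj
          exact (hR _ _ (hq j hj)).1
      · intro i hi j hj hij
        simp only [Finset.coe_range, Set.mem_Iio, Nat.lt_succ_iff] at hi hj
        rw [← hqd i hi, ← hqd j hj, hij]
    simpa using this
  · have := steps_of_descending (R := R) (q := q) (Nat.zero_le _) fun j _ hj => hq j hj
    rwa [hq0, hqn] at this

lemma SimpleGraph.Connected.reaches {G : SimpleGraph V} (hG : G.Connected) (hH : H.Nonempty)
    (x : V) : Reaches G.Adj H x := by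
  obtain ⟨y, hy⟩ := hH
  obtain ⟨w⟩ := hG x y
  exact ⟨_, y, hy, steps_of_walk w⟩

end Steps

section Branches

variable {V : Type*} [DecidableEq V] {G : SimpleGraph V} {N : V → Finset V}

/-- The geometric sum `1 + x + ⋯ + x ^ r`. -/
def geoSum (x : ℕ) : ℕ → ℕ
  | 0 => 1
  | r + 1 => 1 + x * geoSum x r

lemma one_le_geoSum (x r : ℕ) : 1 ≤ geoSum x r := by
  cases r <;> simp [geoSum]

lemma geoSum_eq (x r : ℕ) : geoSum x r = 1 + ∑ i ∈ Finset.Icc 1 r, x ^ i := by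
  have h : ∀ r, geoSum x r = ∑ i ∈ Finset.range (r + 1), x ^ i := by
    intro r
    induction r with
    | zero => simp [geoSum]
    | succ r ih => rw [geoSum, ih, geom_sum_succ (n := r + 1), add_comm]
  rw [h, Finset.sum_range_succ', pow_zero, add_comm, Finset.range_eq_Ico,
    Finset.sum_Ico_add' (fun i => x ^ i) 0 r 1]
  rfl

lemma hPoly_eq (x g : ℕ) : hPoly (x + 3) g = 1 + (x + 3) * geoSum x ((g - 1) / 2 - 1) := by
  rw [hPoly, geoSum_eq, ← Finset.mul_sum, Nat.add_sub_cancel]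
  ring

/-- The vertices reached from `w` in at most `r` steps, avoiding `u` at first and never turning
back. -/
def branch (N : V → Finset V) : V → V → ℕ → Finset V
  | _, w, 0 => {w}
  | u, w, r + 1 => insert w (((N w).erase u).biUnion fun x => branch N w x r)

/-- The vertices reached from `c` in at most `r + 1` steps without turning back. -/
def branchBall (N : V → Finset V) (c : V) (r : ℕ) : Finset V :=
  insert c ((N c).biUnion fun w => branch N c w r)

lemma exists_steps_of_mem_branch {u w y : V} {r : ℕ} (h : y ∈ branch N u w r) :
    ∃ m ≤ r, Steps (fun a b => b ∈ N a) m w y := by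
  induction r generalizing u w with
  | zero =>
    rw [branch, Finset.mem_singleton] at h
    exact ⟨0, le_rfl, h.symm⟩
  | succ r ih =>
    rw [branch, Finset.mem_insert, Finset.mem_biUnion] at h
    rcases h with rfl | ⟨x, hx, hy⟩
    · exact ⟨0, Nat.zero_le _, rfl⟩
    · obtain ⟨m, hm, hs⟩ := ih hy
      exact ⟨m + 1, by omega, x, Finset.mem_of_mem_erase hx, hs⟩

lemma exists_steps_of_mem_branchBall {c y : V} {r : ℕ} (h : y ∈ branchBall N c r) :
    ∃ m ≤ r + 1, Steps (fun a b => b ∈ N a) m c y := by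
  rw [branchBall, Finset.mem_insert, Finset.mem_biUnion] at h
  rcases h with rfl | ⟨x, hx, hy⟩
  · exact ⟨0, Nat.zero_le _, rfl⟩
  · obtain ⟨m, hm, hs⟩ := exists_steps_of_mem_branch hy
    exact ⟨m + 1, by omega, x, hx, hs⟩

lemma exists_path_of_mem_branch (hN : ∀ u w, w ∈ N u → G.Adj u w) {u w y : V} {r : ℕ}
    (huw : w ∈ N u) (hg : ((2 * (r + 1) : ℕ) : ℕ∞) < G.egirth) (h : y ∈ branch N u w r) :
    ∃ q : G.Walk u y, q.IsPath ∧ q.length ≤ r + 1 ∧ q.snd = w := by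
  have hadj := hN _ _ huw
  induction r generalizing u w with
  | zero =>
    rw [branch, Finset.mem_singleton] at h
    subst h
    exact ⟨.cons hadj .nil, by simpa using hadj.ne, by simp, by simp⟩
  | succ r ih =>
    rw [branch, Finset.mem_insert, Finset.mem_biUnion] at h
    rcases h with rfl | ⟨x, hx, hy⟩
    · exact ⟨.cons hadj .nil, by simpa using hadj.ne, by simp, by simp⟩
    · have hxN := Finset.mem_of_mem_erase hx
      have hxu := Finset.ne_of_mem_erase hx
      obtain ⟨q, hq, hql, hqs⟩ := ih hxN
        (lt_of_le_of_lt (by exact_mod_cast (by omega)) hg) hy (hN _ _ hxN)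
      by_cases hu : u ∈ q.support
      · exfalso
        apply hxu
        have h1 : (q.takeUntil u hu).snd = q.snd := q.snd_takeUntil hadj.ne hu
        have h2 := q.length_takeUntil_le_length hu
        have h3 : (Walk.cons hadj.symm (Walk.nil : G.Walk u u)).IsPath := by
          simpa using hadj.ne'
        have h4 := path_unique_of_length_lt_egirth (hq.takeUntil hu) h3
          (lt_of_le_of_lt (by
            rw [Walk.length_cons, Walk.length_nil]
            exact_mod_cast (by omega)) hg)
        rw [← hqs, ← h1, h4]
        simp
      · exact ⟨.cons hadj q, hq.cons hu, by simpa using hql, by simp⟩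

/-- The size of a vertex together with its branches, outside a given set. -/
lemma card_insert_biUnion_branch_sdiff (hN : ∀ u w, w ∈ N u → G.Adj u w) {c : V} {r : ℕ}
    {E : Finset V} (hE : E ⊆ N c) (hg : ((2 * (r + 1) : ℕ) : ℕ∞) < G.egirth) (T : Finset V) :
    (insert c (E.biUnion fun w => branch N c w r) \ T).card =
      (if c ∈ T then 0 else 1) + ∑ w ∈ E, (branch N c w r \ T).card := by
  have hdisj : (E : Set V).PairwiseDisjoint fun w => branch N c w r \ T := by
    intro x hx y hy hxy
    rw [Function.onFun, Finset.disjoint_left]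
    intro z hzx hzy
    obtain ⟨p, hp, hpl, hps⟩ :=
      exists_path_of_mem_branch hN (hE hx) hg (Finset.mem_sdiff.1 hzx).1
    obtain ⟨q, hq, hql, hqs⟩ :=
      exists_path_of_mem_branch hN (hE hy) hg (Finset.mem_sdiff.1 hzy).1
    refine hxy ?_
    rw [← hps, ← hqs, path_unique_of_length_lt_egirth hp hq
      (lt_of_le_of_lt (by exact_mod_cast (by omega)) hg)]
  have hc : c ∉ E.biUnion fun w => branch N c w r := by
    intro h
    obtain ⟨w, hw, hcw⟩ := Finset.mem_biUnion.1 h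
    obtain ⟨p, hp, hpl, hps⟩ := exists_path_of_mem_branch hN (hE hw) hg hcw
    have hpn : p = .nil := by
      cases p with
      | nil => rfl
      | cons h p => exact absurd hp (by simp)
    rw [hpn] at hps
    exact (hN _ _ (hE hw)).ne (by simpa using hps)
  have h1 : (E.biUnion fun w => branch N c w r) \ T = E.biUnion fun w => branch N c w r \ T := by
    ext z; simp only [Finset.mem_sdiff, Finset.mem_biUnion]; tauto
  rw [← Finset.card_biUnion hdisj, ← h1]
  split_ifs with hcT
  · rw [Finset.insert_sdiff_of_mem _ hcT, zero_add]
  · rw [Finset.insert_sdiff_of_notMem _ hcT, Finset.card_insert_of_notMem, add_comm]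
    exact fun h => hc (Finset.mem_sdiff.1 h).1

lemma geoSum_le_card_branch (hN : ∀ u w, w ∈ N u → G.Adj u w) {x r : ℕ}
    (hd : ∀ w, x + 1 ≤ (N w).card) (hg : ((2 * r : ℕ) : ℕ∞) < G.egirth) (u w : V) :
    geoSum x r ≤ (branch N u w r).card := by
  induction r generalizing u w with
  | zero => simp [geoSum, branch]
  | succ r ih =>
    have h1 := card_insert_biUnion_branch_sdiff hN ((N w).erase_subset u) hg ∅
    have h2 := Finset.card_nsmul_le_sum ((N w).erase u) (fun z => (branch N w z r).card)
      (geoSum x r) fun z _ => ih (lt_of_le_of_lt (by exact_mod_cast (by omega)) hg) w z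
    have h3 := Finset.pred_card_le_card_erase (s := N w) (a := u)
    have h4 := Nat.mul_le_mul_right (geoSum x r)
      (show x ≤ ((N w).erase u).card by have := hd w; omega)
    simp only [Finset.sdiff_empty, Finset.notMem_empty, if_false, smul_eq_mul] at h1 h2
    rw [branch, h1, geoSum]
    omega

lemma card_branchBall (hN : ∀ u w, w ∈ N u → G.Adj u w) {x r : ℕ}
    (hd : ∀ w, x + 1 ≤ (N w).card) (hg : ((2 * (r + 1) : ℕ) : ℕ∞) < G.egirth) {c : V}
    (hc : x + 3 ≤ (N c).card) :
    1 + (x + 3) * geoSum x r ≤ (branchBall N c r).card := by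
  have h1 := card_insert_biUnion_branch_sdiff hN (Finset.Subset.refl (N c)) hg ∅
  have h2 := Finset.card_nsmul_le_sum (N c) (fun z => (branch N c z r).card)
    (geoSum x r) fun z _ => geoSum_le_card_branch hN hd
      (lt_of_le_of_lt (by exact_mod_cast (by omega)) hg) c z
  have h4 := Nat.mul_le_mul_right (geoSum x r) hc
  simp only [Finset.sdiff_empty, Finset.notMem_empty, if_false, smul_eq_mul] at h1 h2
  rw [branchBall, h1]
  omega

end Branches

section PathCut

/-- Neighbourhoods `N` obtained from those of `G` by cutting the edges of a path `P`, where `b`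
is the base point from which distances are measured. -/
structure PathCut {V : Type*} (G : SimpleGraph V) (N : V → Finset V) (P : Finset V) (b : V)
    (x ρ : ℕ) : Prop where
  connected : G.Connected
  adj : ∀ u w, w ∈ N u → G.Adj u w
  symm : ∀ u w, w ∈ N u → u ∈ N w
  girth : ((2 * ρ : ℕ) : ℕ∞) < G.egirth
  card_le : ∀ w, x + 1 ≤ (N w).card
  card_le_of_notMem : ∀ w, w ∉ P → x + 3 ≤ (N w).card
  dist_ne : ∀ w ∈ P, ∀ y ∈ N w, G.dist w b ≤ ρ → G.dist w b ≠ G.dist y b + 1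
  base_mem : b ∈ P
  unique : ∀ c, c ∉ P → ∀ y ∈ P, ∀ z ∈ P, G.Adj c y → G.Adj c z → y = z

variable {V : Type*} {G : SimpleGraph V} {N : V → Finset V} {P T : Finset V} {b : V} {x ρ : ℕ}

namespace PathCut

lemma girth_of_le (h : PathCut G N P b x ρ) {n : ℕ} (hn : n ≤ 2 * ρ) : (n : ℕ∞) < G.egirth :=
  lt_of_le_of_lt (by exact_mod_cast hn) h.girth

lemma closer_unique (h : PathCut G N P b x ρ) {w y z : V} (hw : G.dist w b ≤ ρ)
    (hy : y ∈ N w) (hz : z ∈ N w) (hyw : G.dist w b = G.dist y b + 1)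
    (hzw : G.dist w b = G.dist z b + 1) : y = z :=
  closer_neighbor_unique h.connected (h.adj _ _ hy) (h.adj _ _ hz) hyw hzw
    (h.girth_of_le (by omega))

lemma dist_le_succ (h : PathCut G N P b x ρ) {w y : V} (hy : y ∈ N w) :
    G.dist w b ≤ G.dist y b + 1 := by
  have h1 : G.dist w b ≤ G.dist w y + G.dist y b := h.connected.dist_triangle
  have h2 := dist_eq_one_iff_adj.2 (h.adj _ _ hy)
  omega

lemma dist_eq_of_far (h : PathCut G N P b x ρ) {w y : V} (hw : ρ ≤ G.dist w b) (hy : y ∈ N w)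
    (hyb : G.dist y b < ρ) : G.dist w b = ρ ∧ G.dist w b = G.dist y b + 1 := by
  have := h.dist_le_succ hy
  omega

/-- An ascent cannot end on the path. -/
lemma notMem_of_ascent (h : PathCut G N P b x ρ) {u w : V} (huw : w ∈ N u)
    (hd : G.dist w b = G.dist u b + 1) (hw : G.dist w b ≤ ρ) : w ∉ P :=
  fun hwP => h.dist_ne w hwP u (h.symm _ _ huw) hw hd

variable [DecidableEq V]

/-- A far vertex has many far neighbours. -/
lemma card_far (h : PathCut G N P b x ρ) {w : V} (hw : ρ ≤ G.dist w b) (u : V) :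
    x ≤ (((N w).erase u).filter fun y => ρ ≤ G.dist y b).card ∧
      (w ∉ P → x + 1 ≤ (((N w).erase u).filter fun y => ρ ≤ G.dist y b).card) := by
  have h1 := Finset.pred_card_le_card_erase (s := N w) (a := u)
  have h2 := Finset.card_filter_add_card_filter_not (s := (N w).erase u)
    (fun y => ρ ≤ G.dist y b)
  have h3 : (((N w).erase u).filter fun y => ¬ ρ ≤ G.dist y b).card ≤ 1 := by
    rw [Finset.card_le_one]
    intro y hy z hz
    simp only [Finset.mem_filter, Finset.mem_erase, not_le] at hy hz
    have h4 := h.dist_eq_of_far hw hy.1.2 hy.2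
    have h5 := h.dist_eq_of_far hw hz.1.2 hz.2
    exact h.closer_unique h4.1.le hy.1.2 hz.1.2 h4.2 h5.2
  have h4 := h.card_le w
  refine ⟨?_, fun hwP => ?_⟩
  · by_cases hwP : w ∈ P
    · have h5 : (((N w).erase u).filter fun y => ¬ ρ ≤ G.dist y b) = ∅ := by
        rw [Finset.filter_eq_empty_iff]
        intro y hy hyb
        have hyN := Finset.mem_of_mem_erase hy
        have h6 := h.dist_eq_of_far hw hyN (not_le.1 hyb)
        exact h.dist_ne w hwP y hyN h6.1.le h6.2
      rw [h5, Finset.card_empty] at h2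
      omega
    · have := h.card_le_of_notMem w hwP
      omega
  · have := h.card_le_of_notMem w hwP
    omega

lemma le_card_branch_succ (h : PathCut G N P b x ρ) {u w : V} {r s k : ℕ} (hr : r + 1 ≤ ρ)
    {p : V → Prop} [DecidablePred p] (hk : k ≤ (((N w).erase u).filter p).card)
    (hs : ∀ y ∈ N w, y ≠ u → p y → s ≤ (branch N w y r \ T).card) :
    (if w ∈ T then 0 else 1) + k * s ≤ (branch N u w (r + 1) \ T).card := by
  have h1 := card_insert_biUnion_branch_sdiff h.adj ((N w).erase_subset u)
    (h.girth_of_le (n := 2 * (r + 1)) (by omega)) T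
  have h2 := Finset.card_nsmul_le_sum (((N w).erase u).filter p)
    (fun z => (branch N w z r \ T).card) s (by
      intro y hy
      simp only [Finset.mem_filter, Finset.mem_erase] at hy
      exact hs y hy.1.2 hy.1.1 hy.2)
  have h3 := Finset.sum_le_sum_of_subset (f := fun z => (branch N w z r \ T).card)
    (Finset.filter_subset p ((N w).erase u))
  have h4 := Nat.mul_le_mul_right s hk
  rw [smul_eq_mul] at h2
  rw [branch, h1]
  omega

variable (T) in
/-- The size of a branch at a far vertex. -/
lemma card_branch_far (h : PathCut G N P b x ρ) (hT : ∀ y, y ∈ T ↔ G.dist y b < ρ) {r : ℕ}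
    (hr : r ≤ ρ) (u : V) {w : V} (hw : ρ ≤ G.dist w b) :
    geoSum x r ≤ (branch N u w r \ T).card := by
  have hwT : w ∉ T := by rw [hT]; omega
  induction r generalizing u w with
  | zero => simp [geoSum, branch, Finset.sdiff_eq_self_of_disjoint, hwT]
  | succ r ih =>
    have := h.le_card_branch_succ (T := T) hr (h.card_far hw u).1
      (s := geoSum x r) fun y _ _ hy => ih (by omega) w hy (by rw [hT]; omega)
    rwa [if_neg hwT] at this

/-- The size of a branch that starts by moving away from the base point. -/
lemma card_branch_ascent (h : PathCut G N P b x ρ) (hT : ∀ y, y ∈ T ↔ G.dist y b < ρ) {r : ℕ}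
    (hr : r + 1 ≤ ρ) {u w : V} (huw : w ∈ N u) (hd : G.dist w b = G.dist u b + 1)
    (hw : G.dist w b ≤ ρ) (hrw : ρ ≤ G.dist w b + r + 1) :
    (x + 2) * geoSum x r ≤ (branch N u w (r + 1) \ T).card := by
  induction r generalizing u w with
  | zero =>
    refine le_trans ?_ (h.le_card_branch_succ (T := T) (p := fun _ => True) (s := 1)
      (k := x + 2) hr ?_ ?_)
    · simp [geoSum]
    · have h1 := Finset.pred_card_le_card_erase (s := N w) (a := u)
      have := h.card_le_of_notMem w (h.notMem_of_ascent huw hd hw)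
      rw [Finset.filter_true]
      omega
    · intro y hy hyu _
      have hyb : ρ ≤ G.dist y b := by
        by_contra hyb
        rcases hw.lt_or_eq with h1 | h1
        · rcases dist_adj_cases (b := b) h.connected (h.adj _ _ hy) (h.girth_of_le (by omega))
            with h2 | h2
          · exact hyu (h.closer_unique hw hy (h.symm _ _ huw) h2 hd)
          · omega
        · have := h.dist_le_succ hy
          exact hyu (h.closer_unique hw hy (h.symm _ _ huw) (by omega) hd)
      exact h.card_branch_far T hT (Nat.zero_le _) w hyb
  | succ r ih =>
    refine le_trans ?_ (h.le_card_branch_succ (T := T) (p := fun _ => True)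
      (s := geoSum x (r + 1)) (k := x + 2) hr ?_ ?_)
    · omega
    · have h1 := Finset.pred_card_le_card_erase (s := N w) (a := u)
      have := h.card_le_of_notMem w (h.notMem_of_ascent huw hd hw)
      rw [Finset.filter_true]
      omega
    · intro y hy hyu _
      by_cases hyb : ρ ≤ G.dist y b
      · exact h.card_branch_far T hT (by omega) w hyb
      · have h1 : G.dist w b < ρ := by
          by_contra h1
          have := h.dist_le_succ hy
          exact hyu (h.closer_unique hw hy (h.symm _ _ huw) (by omega) hd)
        have h2 : G.dist y b = G.dist w b + 1 := by
          rcases dist_adj_cases (b := b) h.connected (h.adj _ _ hy) (h.girth_of_le (by omega))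
            with h2 | h2
          · exact absurd (h.closer_unique hw hy (h.symm _ _ huw) h2 hd) hyu
          · exact h2
        have h3 := ih (by omega) hy h2 (by omega) (by omega)
        have h4 := one_le_geoSum x r
        rw [geoSum]
        nlinarith

/-- Away from the path, the ball of radius `ρ` is large even outside the vertices close to the
base point. -/
lemma card_branchBall_sdiff (h : PathCut G N P b x ρ) (hT : ∀ y, y ∈ T ↔ G.dist y b < ρ)
    (hρ : 2 ≤ ρ) {c : V} (hc : c ∉ P) :
    1 + (x + 3) * geoSum x (ρ - 1) ≤ (branchBall N c (ρ - 1) \ T).card := by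
  obtain ⟨r, rfl⟩ := Nat.exists_eq_add_of_le' hρ
  rw [show r + 2 - 1 = r + 1 by omega]
  have hs := one_le_geoSum x r
  have hcN := h.card_le_of_notMem c hc
  have h1 := card_insert_biUnion_branch_sdiff h.adj (Finset.Subset.refl (N c))
    (h.girth_of_le (n := 2 * (r + 1 + 1)) (by omega)) T
  rw [branchBall, h1, geoSum]
  have hsub : ∀ E ⊆ N c, ∑ w ∈ E, (branch N c w (r + 1) \ T).card ≤
      ∑ w ∈ N c, (branch N c w (r + 1) \ T).card := fun E hE =>
    Finset.sum_le_sum_of_subset hE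
  by_cases hcb : G.dist c b < r + 2
  · set E := (N c).filter fun y => G.dist c b ≠ G.dist y b + 1 with hE
    have h2 := Finset.card_filter_add_card_filter_not (s := N c)
      (fun y => G.dist c b ≠ G.dist y b + 1)
    have h3 : ((N c).filter fun y => ¬ (G.dist c b ≠ G.dist y b + 1)).card ≤ 1 := by
      rw [Finset.card_le_one]
      intro y hy z hz
      simp only [Finset.mem_filter, not_not] at hy hz
      exact h.closer_unique hcb.le hy.1 hz.1 hy.2 hz.2
    have h4 := Finset.card_nsmul_le_sum E (fun z => (branch N c z (r + 1) \ T).card)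
      ((x + 2) * geoSum x r) (by
        intro y hy
        simp only [hE, Finset.mem_filter] at hy
        have hyd : G.dist y b = G.dist c b + 1 := by
          rcases dist_adj_cases (b := b) h.connected (h.adj _ _ hy.1) (h.girth_of_le (by omega))
            with h2 | h2
          · exact absurd h2 hy.2
          · exact h2
        have hc0 : G.dist c b ≠ 0 := by
          intro h0
          rw [h.connected.dist_eq_zero_iff] at h0
          exact hc (h0 ▸ h.base_mem)
        exact h.card_branch_ascent hT (by omega) hy.1 hyd (by omega) (by omega))
    have h5 := Nat.mul_le_mul_right ((x + 2) * geoSum x r) (show x + 2 ≤ E.card by rw [hE]; omega)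
    have h6 := hsub E (Finset.filter_subset _ _)
    have h7 := Nat.mul_le_mul_left (x + 4) hs
    rw [smul_eq_mul] at h4
    refine le_add_left (le_trans ?_ (h5.trans (h4.trans h6)))
    nlinarith
  · have hcT : c ∉ T := by rw [hT]; omega
    rw [if_neg hcT]
    by_cases hbad : ∃ z ∈ N c, G.dist z b < r + 2
    · obtain ⟨z, hz, hzb⟩ := hbad
      have hzc := h.dist_eq_of_far (not_lt.1 hcb) hz hzb
      set E := (N c).erase z with hE
      have hEc := Finset.card_erase_of_mem hz
      have h2 := Finset.card_nsmul_le_sum E (fun y => (branch N c y (r + 1) \ T).card +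
        if y ∈ P then geoSum x r else 0) (1 + (x + 1) * geoSum x r) (by
          intro y hy
          have hyN := Finset.mem_of_mem_erase hy
          have hyb : r + 2 ≤ G.dist y b := by
            by_contra hyb
            have := h.dist_eq_of_far (not_lt.1 hcb) hyN (not_le.1 hyb)
            exact Finset.ne_of_mem_erase hy
              (h.closer_unique this.1.le hyN hz this.2 hzc.2)
          have hyT : y ∉ T := by rw [hT]; omega
          split_ifs with hyP
          · have := h.card_branch_far T hT (r := r + 1) (by omega) c hyb
            rw [geoSum] at this
            linarith
          · have := h.le_card_branch_succ (T := T) (r := r) (by omega)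
              ((h.card_far hyb c).2 hyP) (s := geoSum x r)
              fun y' _ _ hy' => h.card_branch_far T hT (by omega) y hy'
            rw [if_neg hyT] at this
            omega)
      rw [Finset.sum_add_distrib, ← Finset.sum_filter, Finset.sum_const, smul_eq_mul,
        smul_eq_mul] at h2
      have h3 : (E.filter (· ∈ P)).card ≤ 1 := by
        rw [Finset.card_le_one]
        intro y hy y' hy'
        simp only [hE, Finset.mem_filter, Finset.mem_erase] at hy hy'
        exact h.unique c hc y hy.2 y' hy'.2 (h.adj _ _ hy.1.2) (h.adj _ _ hy'.1.2)
      have h4 := Nat.mul_le_mul_right (geoSum x r) h3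
      have h5 := Nat.mul_le_mul_right (1 + (x + 1) * geoSum x r)
        (show x + 2 ≤ E.card by rw [hE]; omega)
      have h6 := hsub E (Finset.erase_subset _ _)
      nlinarith
    · push Not at hbad
      have h2 := Finset.card_nsmul_le_sum (N c) (fun z => (branch N c z (r + 1) \ T).card)
        (geoSum x (r + 1)) fun y hy => h.card_branch_far T hT (by omega) c (hbad y hy)
      have h3 := Nat.mul_le_mul_right (geoSum x (r + 1)) hcN
      rw [smul_eq_mul] at h2
      rw [geoSum] at h2 h3
      omega

end PathCut

end PathCut

section OneWay

variable {V : Type*} {G : SimpleGraph V} {H K : Finset V} {p : ℕ → V} {k : ℕ}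

/-- `p 0, …, p k` is a path that leaves `H` as quickly as possible. -/
structure IsEscape (G : SimpleGraph V) (H : Finset V) (p : ℕ → V) (k : ℕ) : Prop where
  mem : p 0 ∈ H
  adj : ∀ i < k, G.Adj (p (i + 1)) (p i)
  dist : ∀ i ≤ k, distTo G.Adj H (p i) = i

/-- Adjacency where the edges of the path `p 0, …, p k` may only be traversed forwards. -/
def OneWay (G : SimpleGraph V) (p : ℕ → V) (k : ℕ) (x y : V) : Prop :=
  G.Adj x y ∧ ∀ i < k, x = p (i + 1) → y ≠ p i

/-- Adjacency outside the edges of the path `p 0, …, p k`. -/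
def CutAdj (G : SimpleGraph V) (p : ℕ → V) (k : ℕ) (x y : V) : Prop :=
  OneWay G p k x y ∧ OneWay G p k y x

lemma CutAdj.symm {x y : V} (h : CutAdj G p k x y) : CutAdj G p k y x := ⟨h.2, h.1⟩

lemma CutAdj.steps_symm {n : ℕ} {x y : V} (h : Steps (CutAdj G p k) n x y) :
    Steps (CutAdj G p k) n y x :=
  h.flip.mono fun _ _ h => h.symm

lemma cutAdj_of_ne {x y : V} (hxy : G.Adj x y) (hx : ∀ i ≤ k, x ≠ p i) : CutAdj G p k x y :=
  ⟨⟨hxy, fun _ hi h => absurd h (hx _ hi)⟩, hxy.symm, fun i hi _ h => hx i hi.le h⟩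

lemma exists_of_not_cutAdj {x y : V} (hxy : G.Adj x y) (h : ¬ CutAdj G p k x y) :
    ∃ i < k, (x = p (i + 1) ∧ y = p i) ∨ (x = p i ∧ y = p (i + 1)) := by
  by_contra! hc
  exact h ⟨⟨hxy, fun i hi h1 => (hc i hi).1 h1⟩, hxy.symm, fun i hi h1 h2 => (hc i hi).2 h2 h1⟩

namespace IsEscape

lemma injOn (h : IsEscape G H p k) {i j : ℕ} (hi : i ≤ k) (hj : j ≤ k) (hij : p i = p j) :
    i = j := by
  rw [← h.dist i hi, hij, h.dist j hj]

lemma notMem (h : IsEscape G H p k) {i : ℕ} (h1 : 1 ≤ i) (hi : i ≤ k) : p i ∉ H := by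
  intro hm
  have := h.dist i hi
  rw [distTo_eq_zero_of_mem hm] at this
  omega

lemma oneWay (h : IsEscape G H p k) {i : ℕ} (hi : i < k) : OneWay G p k (p i) (p (i + 1)) := by
  refine ⟨(h.adj i hi).symm, fun j hj h1 h2 => ?_⟩
  have := h.injOn hi.le (Nat.succ_le_of_lt hj) h1
  have := h.injOn (Nat.succ_le_of_lt hi) hj.le h2
  omega

/-- Since no edge of the path is a bridge, its end reaches `H` without turning back on it. -/
lemma reaches (h : IsEscape G H p k) (hG : Bridgeless G) : Reaches (OneWay G p k) H (p k) := by
  classical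
  by_contra hr
  set X : V → Prop := fun x => ∃ n, Steps (OneWay G p k) n (p k) x with hX
  have hXH : ∀ x, X x → x ∉ H := fun x ⟨n, hn⟩ hx => hr ⟨n, x, hx, hn⟩
  have hup : ∀ i j, i ≤ j → j ≤ k → X (p i) → X (p j) := fun i j hij hj ⟨n, hn⟩ =>
    ⟨_, hn.trans (steps_of_ascending hij fun a _ ha => h.oneWay (by omega))⟩
  have hex : ∃ j, X (p j) := ⟨k, 0, rfl⟩
  obtain ⟨i, hi⟩ : ∃ i, Nat.find hex = i + 1 := Nat.exists_eq_add_one_of_ne_zero fun h0 =>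
    hXH _ (h0 ▸ Nat.find_spec hex) h.mem
  have hik : i + 1 ≤ k := hi ▸ Nat.find_min' hex ⟨0, rfl⟩
  have hXi : X (p (i + 1)) := hi ▸ Nat.find_spec hex
  have hnX : ¬ X (p i) := Nat.find_min hex (by omega)
  have hcl : ∀ x y, X x → (G.deleteEdges {s(p (i + 1), p i)}).Adj x y → X y := by
    intro x y hx hxy
    rw [deleteEdges_adj, Set.mem_singleton_iff] at hxy
    by_contra hy
    have hno : ¬ OneWay G p k x y := fun ho => let ⟨n, hn⟩ := hx; hy ⟨n + 1, hn.snoc ho⟩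
    rw [OneWay, not_and] at hno
    have := hno hxy.1
    push Not at this
    obtain ⟨j, hj, rfl, rfl⟩ := this
    have h1 := Nat.find_min' hex hx
    have h2 : j < i + 1 := by
      by_contra h2
      exact hy (hup _ _ (not_lt.1 h2) hj.le hXi)
    obtain rfl : j = i := by omega
    exact hxy.2 rfl
  refine hG.2 s(p (i + 1), p i) ?_
  rw [isBridge_iff]
  rintro ⟨w⟩
  have : ∀ {a b : V}, (G.deleteEdges {s(p (i + 1), p i)}).Walk a b → X a → X b := by
    intro a b w
    induction w with
    | nil => exact id
    | cons hadj _ ih => exact fun ha => ih (hcl _ _ ha hadj)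
  exact hnX (this w hXi)

/-- A walk to `H` either avoids the edges of the path or meets the path on the way. -/
lemma split (h : IsEscape G H p k) {n : ℕ} {w y : V} (hw : Steps G.Adj n w y) (hy : y ∈ H) :
    (∃ m ≤ n, ∃ z ∈ H, Steps (CutAdj G p k) m w z) ∨
      ∃ i j, 1 ≤ i ∧ i ≤ k ∧ j + i ≤ n ∧ Steps (CutAdj G p k) j w (p i) := by
  induction n generalizing w with
  | zero => exact .inl ⟨0, le_rfl, y, hy, hw⟩
  | succ n ih =>
    have hd := distTo_le hw hy
    obtain ⟨z, hwz, hz⟩ := hw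
    by_cases hc : CutAdj G p k w z
    · rcases ih hz with ⟨m, hm, z', hz', hs⟩ | ⟨i, j, h1, h2, h3, hs⟩
      · exact .inl ⟨m + 1, by omega, z', hz', z, hc, hs⟩
      · exact .inr ⟨i, j + 1, h1, h2, by omega, z, hc, hs⟩
    · obtain ⟨i, hik, rfl⟩ : ∃ i ≤ k, w = p i := by
        obtain ⟨i, hi, ⟨rfl, -⟩ | ⟨rfl, -⟩⟩ := exists_of_not_cutAdj hwz hc
        exacts [⟨i + 1, hi, rfl⟩, ⟨i, hi.le, rfl⟩]
      rcases Nat.eq_zero_or_pos i with rfl | hi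
      · exact .inl ⟨0, Nat.zero_le _, _, h.mem, rfl⟩
      · rw [h.dist i hik] at hd
        exact .inr ⟨i, 0, hi, hik, by omega, rfl⟩

lemma dist_one (h : IsEscape G H p k) (hG : G.Connected) {i : ℕ} (h1 : 1 ≤ i) (hi : i ≤ k) :
    G.dist (p i) (p 1) = i - 1 := by
  refine le_antisymm (steps_of_descending h1 fun a _ ha => h.adj a (by omega)).dist_le ?_
  obtain ⟨w, hw⟩ := hG.exists_walk_length_eq_dist (p i) (p 1)
  have h2 := (hG.reaches ⟨_, h.mem⟩ (p 1)).distTo_le_add (steps_of_walk w)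
  rw [hw, h.dist i hi, h.dist 1 (by omega)] at h2
  omega

/-- The path meets the neighbourhood of any other vertex at most once. -/
lemma neighbor_unique (h : IsEscape G H p k) (hG : G.Connected) (hg : ((4 : ℕ) : ℕ∞) < G.egirth)
    {c : V} (hc : ∀ i ≤ k, c ≠ p i) {i j : ℕ} (hi : i ≤ k) (hj : j ≤ k) (hci : G.Adj c (p i))
    (hcj : G.Adj c (p j)) : i = j := by
  wlog hij : i < j generalizing i j
  · by_contra hne
    exact hne (this hj hi hcj hci (by omega)).symm
  exfalso
  have h1 := (hG.reaches ⟨_, h.mem⟩ c).distTo_le_add (.single hcj.symm)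
  have h2 := (hG.reaches ⟨_, h.mem⟩ (p i)).distTo_le_add (.single hci)
  rw [h.dist j hj] at h1
  rw [h.dist i hi] at h2
  have hne : p i ≠ p j := fun he => hij.ne (h.injOn hi hj he)
  have hp : (Walk.cons hci.symm (Walk.cons hcj Walk.nil)).IsPath := by
    simp [hci.ne', hcj.ne, hne]
  obtain rfl | rfl : j = i + 1 ∨ j = i + 2 := by omega
  · have hq : (Walk.cons (h.adj i hj).symm Walk.nil).IsPath := by simpa using hne
    have := path_unique_of_length_lt_egirth hp hq
      (lt_of_le_of_lt (by simp only [Walk.length_cons, Walk.length_nil]; norm_num) hg)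
    simpa using congrArg Walk.length this
  · have hq : (Walk.cons (h.adj i (by omega)).symm
        (Walk.cons (h.adj (i + 1) hj).symm Walk.nil)).IsPath := by
      simp [hne, (h.adj i (by omega)).ne', (h.adj (i + 1) hj).ne']
    have := path_unique_of_length_lt_egirth hp hq
      (lt_of_le_of_lt (by simp only [Walk.length_cons, Walk.length_nil]; norm_num) hg)
    exact hc (i + 1) (by omega) (by simpa using congrArg Walk.snd this)

end IsEscape

/-- `A` orients some of the edges of `G` within `K`. -/
structure IsPartialOrientation (G : SimpleGraph V) (A : V → V → Prop) (K : Finset V) : Prop where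
  adj : ∀ x y, A x y → G.Adj x y
  asymm : ∀ x y, A x y → ¬ A y x
  mem : ∀ x y, A x y → x ∈ K ∧ y ∈ K

lemma IsPartialOrientation.flip {A : V → V → Prop} (h : IsPartialOrientation G A K) :
    IsPartialOrientation G (fun x y => A y x) K :=
  ⟨fun x y hxy => (h.adj y x hxy).symm, fun x y hxy => h.asymm y x hxy,
    fun x y hxy => (h.mem y x hxy).symm⟩

/-- The relation `A` together with the arcs of `p 0, …, p k` and of `q l, …, q j`. -/
def addArcs (A : V → V → Prop) (p : ℕ → V) (k : ℕ) (q : ℕ → V) (j l : ℕ) (x y : V) : Prop :=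
  A x y ∨ (∃ i < k, x = p i ∧ y = p (i + 1)) ∨ ∃ i, j ≤ i ∧ i < l ∧ x = q (i + 1) ∧ y = q i

/-- `q 0, …, q l` is a shortest way from the end of the path `p` back to `H`, read backwards. -/
structure IsReturn (G : SimpleGraph V) (H : Finset V) (p : ℕ → V) (k : ℕ) (q : ℕ → V) (l : ℕ) :
    Prop where
  mem : q 0 ∈ H
  last : q l = p k
  oneWay : ∀ j < l, OneWay G p k (q (j + 1)) (q j)
  dist : ∀ j ≤ l, distTo (OneWay G p k) H (q j) = j

lemma IsEscape.exists_return (h : IsEscape G H p k) (hG : Bridgeless G) :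
    ∃ q l, IsReturn G H p k q l := by
  obtain ⟨q, h0, hl, ho, hd⟩ := (h.reaches hG).exists_geodesic
  exact ⟨q, _, h0, hl, ho, hd⟩

namespace IsReturn

variable {A : V → V → Prop} {q : ℕ → V} {j l : ℕ}

lemma injOn (h : IsReturn G H p k q l) {i j : ℕ} (hi : i ≤ l) (hj : j ≤ l) (hij : q i = q j) :
    i = j := by
  rw [← h.dist i hi, hij, h.dist j hj]

lemma notMem (h : IsReturn G H p k q l) {i : ℕ} (h1 : 1 ≤ i) (hi : i ≤ l) : q i ∉ H := by
  intro hm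
  have := h.dist i hi
  rw [distTo_eq_zero_of_mem hm] at this
  omega

lemma reaches (h : IsReturn G H p k q l) {i : ℕ} (hi : i ≤ l) :
    Reaches (OneWay G p k) H (q i) :=
  ⟨_, _, h.mem, steps_of_descending (Nat.zero_le i) fun a _ ha => h.oneWay a (by omega)⟩

/-- Every vertex reaches `H` without turning back on the path. -/
lemma reaches_all (h : IsReturn G H p k q l) (hp : IsEscape G H p k) (hG : G.Connected) (u : V) :
    Reaches (OneWay G p k) H u := by
  obtain ⟨n, y, hy, hs⟩ := hG.reaches ⟨_, hp.mem⟩ u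
  rcases hp.split hs hy with ⟨m, -, z, hz, hs'⟩ | ⟨i, m, -, hi, -, hs'⟩
  · exact ⟨m, z, hz, hs'.mono fun _ _ h => h.1⟩
  · refine .of_steps ((hs'.mono fun _ _ h => h.1).trans
      (steps_of_ascending hi fun a _ ha => hp.oneWay ha)) ?_
    rw [← h.last]
    exact h.reaches le_rfl

lemma pos (h : IsReturn G H p k q l) (hp : IsEscape G H p k) (hk : 1 ≤ k) : 1 ≤ l := by
  by_contra hl
  obtain rfl : l = 0 := by omega
  exact hp.notMem hk le_rfl (h.last ▸ h.mem)

/-- Adding the arcs of the path and of the way back keeps a partial orientation. -/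
lemma isPartialOrientation_addArcs [DecidableEq V] (h : IsReturn G H p k q l)
    (hp : IsEscape G H p k) (hA : IsPartialOrientation G A K) (hp0 : p 0 ∈ K)
    (hpK : ∀ i, 1 ≤ i → i ≤ k → p i ∉ K) (hqj : q j ∈ K) (hqK : ∀ i, j < i → i ≤ l → q i ∉ K) :
    IsPartialOrientation G (addArcs A p k q j l)
      (K ∪ (Finset.Icc 1 k).image p ∪ (Finset.Ioc j l).image q) := by
  refine ⟨?_, ?_, ?_⟩
  · rintro x y (hxy | ⟨i, hi, rfl, rfl⟩ | ⟨i, hj, hi, rfl, rfl⟩)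
    · exact hA.adj _ _ hxy
    · exact (hp.adj i hi).symm
    · exact (h.oneWay i hi).1
  · rintro x y (hxy | ⟨i, hi, rfl, rfl⟩ | ⟨i, hj, hi, rfl, rfl⟩) (hyx | ⟨i', hi', h1, h2⟩ |
      ⟨i', hj', hi', h1, h2⟩)
    · exact hA.asymm _ _ hxy hyx
    · exact hpK (i' + 1) (by omega) hi' (h2 ▸ (hA.mem _ _ hxy).1)
    · exact hqK (i' + 1) (by omega) hi' (h1 ▸ (hA.mem _ _ hxy).2)
    · exact hpK (i + 1) (by omega) hi (hA.mem _ _ hyx).1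
    · have := hp.injOn hi hi'.le h1
      have := hp.injOn hi.le hi' h2
      omega
    · exact (h.oneWay i' hi').2 i hi h1.symm h2.symm
    · exact hqK (i + 1) (by omega) hi (hA.mem _ _ hyx).2
    · exact (h.oneWay i hi).2 i' hi' h2 h1
    · have := h.injOn (Nat.succ_le_of_lt hi) hi'.le h2
      have := h.injOn hi.le (Nat.succ_le_of_lt hi') h1
      omega
  · have hP : ∀ i ≤ k, p i ∈ K ∪ (Finset.Icc 1 k).image p ∪ (Finset.Ioc j l).image q := by
      intro i hi
      rcases Nat.eq_zero_or_pos i with rfl | h0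
      · simp [hp0]
      · exact Finset.mem_union_left _ (Finset.mem_union_right _
          (Finset.mem_image_of_mem _ (Finset.mem_Icc.2 ⟨h0, hi⟩)))
    have hQ : ∀ i, j ≤ i → i ≤ l →
        q i ∈ K ∪ (Finset.Icc 1 k).image p ∪ (Finset.Ioc j l).image q := by
      intro i hji hi
      rcases hji.eq_or_lt with rfl | h0
      · simp [hqj]
      · exact Finset.mem_union_right _ (Finset.mem_image_of_mem _ (Finset.mem_Ioc.2 ⟨h0, hi⟩))
    rintro x y (hxy | ⟨i, hi, rfl, rfl⟩ | ⟨i, hj, hi, rfl, rfl⟩)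
    · have := hA.mem _ _ hxy
      simp [this.1, this.2]
    · exact ⟨hP i hi.le, hP _ hi⟩
    · exact ⟨hQ _ (by omega) hi, hQ _ hj hi.le⟩

end IsReturn

lemma steps_addArcs_path {A : V → V → Prop} {q : ℕ → V} {a b j l : ℕ} (hab : a ≤ b)
    (hb : b ≤ k) : Steps (addArcs A p k q j l) (b - a) (p a) (p b) :=
  steps_of_ascending hab fun i _ hi => .inr (.inl ⟨i, by omega, rfl, rfl⟩)

lemma steps_addArcs_return {A : V → V → Prop} {q : ℕ → V} {a b j l : ℕ} (hj : j ≤ a)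
    (hab : a ≤ b) (hb : b ≤ l) : Steps (addArcs A p k q j l) (b - a) (q b) (q a) :=
  steps_of_descending hab fun i _ hi => .inr (.inr ⟨i, by omega, by omega, rfl, rfl⟩)

end OneWay

section CutNeighbors

variable {V : Type*} [Fintype V] {G : SimpleGraph V} {H : Finset V} {p : ℕ → V} {k x ρ : ℕ}

open Classical in
/-- The neighbours of `w` outside the edges of the path `p 0, …, p k`. -/
noncomputable def cutNbrs (G : SimpleGraph V) (p : ℕ → V) (k : ℕ) (w : V) : Finset V :=
  {y | CutAdj G p k w y}

lemma mem_cutNbrs {w y : V} : y ∈ cutNbrs G p k w ↔ CutAdj G p k w y := by simp [cutNbrs]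

variable [DecidableRel G.Adj]

lemma card_cutNbrs_of_notMem (hδ : x + 3 ≤ G.minDegree) {w : V} (hw : ∀ i ≤ k, w ≠ p i) :
    x + 3 ≤ (cutNbrs G p k w).card := by
  refine (hδ.trans (G.minDegree_le_degree w)).trans (Finset.card_le_card fun y hy => ?_)
  rw [mem_neighborFinset] at hy
  exact mem_cutNbrs.2 (cutAdj_of_ne hy hw)

namespace IsEscape

lemma card_cutNbrs (h : IsEscape G H p k) (hδ : x + 3 ≤ G.minDegree) (w : V) :
    x + 1 ≤ (cutNbrs G p k w).card := by
  classical
  by_cases hw : ∃ i ≤ k, w = p i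
  · obtain ⟨i, hi, rfl⟩ := hw
    have h1 : G.neighborFinset (p i) ⊆ cutNbrs G p k (p i) ∪ {p (i - 1), p (i + 1)} := by
      intro y hy
      rw [mem_neighborFinset] at hy
      by_cases hc : CutAdj G p k (p i) y
      · exact Finset.mem_union_left _ (mem_cutNbrs.2 hc)
      · refine Finset.mem_union_right _ ?_
        obtain ⟨j, hj, ⟨h2, rfl⟩ | ⟨h2, rfl⟩⟩ := exists_of_not_cutAdj hy hc
        · obtain rfl := h.injOn hi hj h2
          simp
        · obtain rfl := h.injOn hi hj.le h2
          simp
    have h2 := Finset.card_le_card h1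
    have h3 := Finset.card_union_le (cutNbrs G p k (p i)) {p (i - 1), p (i + 1)}
    have h4 := Finset.card_le_two (a := p (i - 1)) (b := p (i + 1))
    have h5 := hδ.trans (G.minDegree_le_degree (p i))
    rw [← card_neighborFinset_eq_degree] at h5
    omega
  · push Not at hw
    have := card_cutNbrs_of_notMem hδ hw
    omega

/-- Cutting the edges of the path leaves neighbourhoods to which the ball estimate applies. -/
lemma pathCut [DecidableEq V] (h : IsEscape G H p k) (hG : G.Connected) (hk : 1 ≤ k)
    (hδ : x + 3 ≤ G.minDegree) (hρ : 2 ≤ ρ) (hg : ((2 * ρ : ℕ) : ℕ∞) < G.egirth) :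
    PathCut G (cutNbrs G p k) ((Finset.range (k + 1)).image p) (p 1) x ρ := by
  have hP : ∀ {w}, w ∉ (Finset.range (k + 1)).image p ↔ ∀ i ≤ k, w ≠ p i := by
    intro w
    simp only [Finset.mem_image, Finset.mem_range, Nat.lt_succ_iff, not_exists, not_and]
    exact ⟨fun h i hi he => h i hi he.symm, fun h i hi he => h i hi he.symm⟩
  refine ⟨hG, fun u w h => (mem_cutNbrs.1 h).1.1, fun u w h => ?_, hg, h.card_cutNbrs hδ,
    fun w hw => card_cutNbrs_of_notMem hδ (hP.1 hw), ?_, ?_, ?_⟩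
  · exact mem_cutNbrs.2 (mem_cutNbrs.1 h).symm
  · intro w hw y hy hwρ hwy
    simp only [Finset.mem_image, Finset.mem_range, Nat.lt_succ_iff] at hw
    obtain ⟨i, hi, rfl⟩ := hw
    rw [mem_cutNbrs] at hy
    have huniq : ∀ z, G.Adj (p i) z → G.dist (p i) (p 1) = G.dist z (p 1) + 1 → y = z :=
      fun z hz hzd => closer_neighbor_unique hG hy.1.1 hz hwy hzd
        (lt_of_le_of_lt (by exact_mod_cast (by omega)) hg)
    rcases i with _ | _ | i
    · have h1 := huniq (p 1) (h.adj 0 hk).symm (by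
        rw [dist_self, dist_eq_one_iff_adj]; exact (h.adj 0 hk).symm)
      exact hy.2.2 0 hk h1 rfl
    · rw [dist_self] at hwy
      omega
    · have h1 := huniq (p (i + 1)) (h.adj _ hi) (by
        rw [h.dist_one hG (by omega) hi, h.dist_one hG (by omega) (by omega)]; rfl)
      exact hy.1.2 (i + 1) hi rfl h1
  · exact Finset.mem_image_of_mem _ (Finset.mem_range.2 (by omega))
  · intro c hc y hy z hz hcy hcz
    simp only [Finset.mem_image, Finset.mem_range, Nat.lt_succ_iff] at hy hz
    obtain ⟨i, hi, rfl⟩ := hy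
    obtain ⟨j, hj, rfl⟩ := hz
    rw [h.neighbor_unique hG (lt_of_le_of_lt (by exact_mod_cast (by omega)) hg) (hP.1 hc) hi hj
      hcy hcz]

end IsEscape

end CutNeighbors

section Gain

/-- Choosing every `g`-th element of a finite set of positive integers. -/
lemma exists_sparse_subset {S : Finset ℕ} {g m : ℕ} (hg : 1 ≤ g) (hS : ∀ a ∈ S, 1 ≤ a)
    (hm : m * g ≤ S.card) :
    ∃ c : ℕ → ℕ, (∀ t < m, c t ∈ S ∧ g ≤ c t) ∧ (∀ s t, s < t → t < m → c s + g ≤ c t) ∧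
      (m * g < S.card → ∃ b ∈ S, ∀ t < m, c t < b) := by
  have hfin : {a | a ∈ S}.Finite := S.finite_toSet
  have hcard : hfin.toFinset.card = S.card := by
    congr 1
    ext a
    simp
  set f : ℕ → ℕ := Nat.nth (· ∈ S) with hf
  have hmem : ∀ i < S.card, f i ∈ S := fun i hi =>
    Nat.nth_mem_of_lt_card hfin (by rw [hcard]; exact hi)
  have hmono : ∀ i j, i < j → j < S.card → f i < f j := fun i j hij hj =>
    Nat.nth_strictMonoOn hfin (by rw [Set.mem_Iio, hcard]; omega)
      (by rw [Set.mem_Iio, hcard]; exact hj) hij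
  have hgap : ∀ i n, i + n < S.card → f i + n ≤ f (i + n) := by
    intro i n
    induction n with
    | zero => simp
    | succ n ih =>
      intro h
      have h1 := ih (by omega)
      have h2 := hmono (i + n) (i + (n + 1)) (by omega) h
      omega
  have hidx : ∀ t < m, t * g + g ≤ m * g := fun t ht => by
    have := Nat.mul_le_mul_right g (Nat.succ_le_of_lt ht)
    rwa [Nat.succ_mul] at this
  refine ⟨fun t => f (t * g + g - 1), fun t ht => ⟨hmem _ ?_, ?_⟩, fun s t hst ht => ?_,
    fun h => ⟨f (m * g), hmem _ h, fun t ht => ?_⟩⟩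
  · have := hidx t ht
    omega
  · have h1 := hidx t ht
    have h2 := hgap 0 (t * g + g - 1) (by omega)
    have h3 := hS _ (hmem 0 (by omega))
    rw [zero_add] at h2
    change g ≤ f _
    have := Nat.zero_le (t * g)
    omega
  · have h1 := hidx t ht
    have h2 := Nat.mul_le_mul_right g (Nat.succ_le_of_lt hst)
    rw [Nat.succ_mul] at h2
    obtain ⟨n, hn⟩ := Nat.exists_eq_add_of_le (show s * g + g - 1 + g ≤ t * g + g - 1 by omega)
    have h3 := hgap (s * g + g - 1) (g + n) (by omega)
    change f _ + g ≤ f _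
    rw [hn, add_assoc]
    omega
  · have h1 := hidx t ht
    exact hmono _ _ (by omega) h

lemma mul_le_card_biUnion_branchBall {V : Type*} [DecidableEq V] {N : V → Finset V}
    {d : V → ℕ} (hd : ∀ u w, w ∈ N u → d u ≤ d w + 1 ∧ d w ≤ d u + 1) {r m B : ℕ} {c : ℕ → V}
    (hc : ∀ s t, s < t → t < m → d (c s) + 2 * (r + 1) < d (c t)) {T : Finset V}
    (hB : ∀ t < m, B ≤ (branchBall N (c t) r \ T).card) :
    m * B ≤ ((Finset.range m).biUnion fun t => branchBall N (c t) r \ T).card := by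
  have hs : ∀ {n x y}, Steps (fun a b => b ∈ N a) n x y → d x ≤ d y + n ∧ d y ≤ d x + n := by
    intro n
    induction n with
    | zero => rintro x y rfl; simp
    | succ n ih =>
      rintro x y ⟨z, hz, hzy⟩
      have h1 := hd _ _ hz
      have h2 := ih hzy
      omega
  have hdisj : ∀ s t, s < t → t < m → Disjoint (branchBall N (c s) r \ T)
      (branchBall N (c t) r \ T) := by
    intro s t hst ht
    rw [Finset.disjoint_left]
    intro w h1 h2
    obtain ⟨n1, hn1, hs1⟩ := exists_steps_of_mem_branchBall (Finset.mem_sdiff.1 h1).1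
    obtain ⟨n2, hn2, hs2⟩ := exists_steps_of_mem_branchBall (Finset.mem_sdiff.1 h2).1
    have h3 := hs hs1
    have h4 := hs hs2
    have h5 := hc s t hst ht
    omega
  rw [Finset.card_biUnion]
  · have := Finset.card_nsmul_le_sum (Finset.range m)
      (fun t => (branchBall N (c t) r \ T).card) B fun t ht => hB t (Finset.mem_range.1 ht)
    simpa using this
  · intro s hs' t ht hne
    rw [Finset.coe_range, Set.mem_Iio] at hs' ht
    rcases Nat.lt_or_gt_of_ne hne with h | h
    · exact hdisj s t h ht
    · exact (hdisj t s h hs').symm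

variable {V : Type*} [Fintype V] [DecidableEq V] {G : SimpleGraph V} [DecidableRel G.Adj]
  {H : Finset V} {p q : ℕ → V} {k l x ρ g : ℕ}

/-- Disjoint balls along an escape path give new vertices close to the path. -/
lemma IsEscape.exists_gain {L : ℕ} (h : IsEscape G H p (L * g)) (hG : G.Connected)
    (hδ : x + 3 ≤ G.minDegree) (hρ : 1 ≤ ρ) (hρg : 2 * ρ < g)
    (hg : ((2 * ρ : ℕ) : ℕ∞) < G.egirth) :
    ∃ U : Finset V, (∀ w ∈ U, ρ < distTo G.Adj H w) ∧
      (∀ w ∈ U, ∃ i ≤ L * g, ∃ m ≤ ρ, Steps G.Adj m w (p i)) ∧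
      L * (1 + (x + 3) * geoSum x (ρ - 1)) ≤ U.card := by
  obtain ⟨r, rfl⟩ := Nat.exists_eq_add_of_le' hρ
  rw [Nat.add_sub_cancel]
  have hreach := hG.reaches ⟨_, h.mem⟩
  have hN : ∀ u w, w ∈ G.neighborFinset u → G.Adj u w := fun u w h => by simpa using h
  have hdeg : ∀ w, x + 3 ≤ (G.neighborFinset w).card := fun w =>
    hδ.trans (G.minDegree_le_degree w)
  have hidx : ∀ t < L, g ≤ (t + 1) * g ∧ (t + 1) * g ≤ L * g := fun t ht =>
    ⟨Nat.le_mul_of_pos_left g (Nat.succ_pos t), Nat.mul_le_mul_right g ht⟩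
  refine ⟨(Finset.range L).biUnion fun t =>
    branchBall (fun w => G.neighborFinset w) (p ((t + 1) * g)) r \ ∅, ?_, ?_, ?_⟩
  · intro w hw
    simp only [Finset.mem_biUnion, Finset.mem_range, Finset.sdiff_empty] at hw
    obtain ⟨t, ht, hw⟩ := hw
    obtain ⟨m, hm, hs⟩ := exists_steps_of_mem_branchBall hw
    have h1 := (hreach w).distTo_le_add (hs.mono hN)
    rw [h.dist _ (hidx t ht).2] at h1
    have := (hidx t ht).1
    omega
  · intro w hw
    simp only [Finset.mem_biUnion, Finset.mem_range, Finset.sdiff_empty] at hw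
    obtain ⟨t, ht, hw⟩ := hw
    obtain ⟨m, hm, hs⟩ := exists_steps_of_mem_branchBall hw
    exact ⟨_, (hidx t ht).2, m, hm, (hs.mono hN).flip.mono fun _ _ h => G.adj_symm h⟩
  · refine mul_le_card_biUnion_branchBall (d := distTo G.Adj H) ?_ ?_ ?_
    · intro u w hw
      have h1 := (hreach w).distTo_le_add (.single (hN u w hw))
      have h2 := (hreach u).distTo_le_add (.single (hN u w hw).symm)
      omega
    · intro s t hst ht
      rw [h.dist _ (hidx t ht).2, h.dist _ (hidx s (by omega)).2]
      have := Nat.mul_le_mul_right g (Nat.succ_le_succ (Nat.succ_le_of_lt hst))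
      rw [Nat.succ_mul (s + 1)] at this
      change (s + 1) * g + g ≤ (t + 1) * g at this
      omega
    · intro t ht
      rw [Finset.sdiff_empty]
      exact card_branchBall hN (fun w => by have := hdeg w; omega) hg (hdeg _)

/-- Disjoint balls along a way back give new vertices close to it. -/
lemma IsReturn.exists_gain (hq : IsReturn G H p k q l) (h : IsEscape G H p k)
    (hG : G.Connected) (hδ : x + 3 ≤ G.minDegree) (hρ : 1 ≤ ρ) (hρg : 2 * ρ < g) (hk : ρ < k)
    (hg : ((2 * ρ : ℕ) : ℕ∞) < G.egirth) {S : Finset ℕ}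
    (hS : ∀ a ∈ S, 1 ≤ a ∧ a < l ∧ ∀ i ≤ k, q a ≠ p i) {m : ℕ} (hm : m * g ≤ S.card) :
    ∃ U : Finset V, (∀ w ∈ U, ρ < distTo G.Adj H w) ∧
      (∀ w ∈ U, ∃ j ≤ l, ∃ m ≤ ρ, Steps G.Adj m w (q j)) ∧
      m * (1 + (x + 3) * geoSum x (ρ - 1)) ≤ U.card + 1 ∧
      (2 ≤ ρ ∨ m * g < S.card → m * (1 + (x + 3) * geoSum x (ρ - 1)) ≤ U.card) := by
  obtain ⟨r, rfl⟩ := Nat.exists_eq_add_of_le' hρ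
  rw [Nat.add_sub_cancel]
  have hreach := hG.reaches ⟨_, h.mem⟩
  obtain ⟨c, hcS, hgap, hlast⟩ := exists_sparse_subset (g := g) (by omega)
    (fun a ha => (hS a ha).1) hm
  have hcut : ∀ a b, b ∈ cutNbrs G p k a → CutAdj G p k a b := fun a b h => mem_cutNbrs.1 h
  have hcutG : ∀ {n a b}, Steps (CutAdj G p k) n a b → Steps G.Adj n a b :=
    fun hs => hs.mono fun _ _ h => h.1.1
  have hcutO : ∀ {n a b}, Steps (CutAdj G p k) n a b → Steps (OneWay G p k) n a b :=
    fun hs => hs.mono fun _ _ h => h.1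
  set d := distTo (OneWay G p k) H with hd
  have hdc : ∀ t < m, d (q (c t)) = c t := fun t ht => hq.dist _ (hS _ (hcS t ht).1).2.1.le
  have hball : ∀ t < m, ∀ w ∈ branchBall (cutNbrs G p k) (q (c t)) r,
      ∃ n ≤ r + 1, Steps (CutAdj G p k) n (q (c t)) w := by
    intro t _ w hw
    obtain ⟨n, hn, hs⟩ := exists_steps_of_mem_branchBall hw
    exact ⟨n, hn, hs.mono hcut⟩
  have hdlip : ∀ u w n, Steps (CutAdj G p k) n u w → Reaches (OneWay G p k) H u →
      d u ≤ n + d w ∧ d w ≤ n + d u := fun u w n hs hr =>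
    have h1 := hcutO (CutAdj.steps_symm hs)
    ⟨(hr.of_steps h1).distTo_le_add (hcutO hs), hr.distTo_le_add h1⟩
  have hall := hq.reaches_all h hG
  set T : Finset V := {w | G.dist w (p 1) < r + 1} with hT
  have hfar : ∀ t < m, ∀ w ∈ branchBall (cutNbrs G p k) (q (c t)) r, w ∉ T →
      r + 1 < distTo G.Adj H w := by
    intro t ht w hw hwT
    by_contra hle
    obtain ⟨y, hy, hs⟩ := (hreach w).exists_steps
    obtain ⟨n, hn, hsw⟩ := hball t ht w hw
    rcases h.split hs hy with ⟨n', hn', z, hz, hs'⟩ | ⟨i, j, h1, h2, h3, hs'⟩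
    · have h4 : d w ≤ n' := distTo_le (hcutO hs') hz
      have h5 := (hdlip _ _ _ hsw (hall _)).1
      rw [hdc t ht] at h5
      have := (hcS t ht).2
      omega
    · apply hwT
      rw [hT, Finset.mem_filter]
      have h4 := (hcutG hs').dist_le
      have h5 : G.dist w (p 1) ≤ G.dist w (p i) + G.dist (p i) (p 1) := hG.dist_triangle
      rw [h.dist_one hG h1 h2] at h5
      exact ⟨Finset.mem_univ _, by omega⟩
  have hcard : ∀ (T' : Finset V) (B : ℕ),
      (∀ t < m, B ≤ (branchBall (cutNbrs G p k) (q (c t)) r \ T').card) →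
      m * B ≤ ((Finset.range m).biUnion fun t =>
        branchBall (cutNbrs G p k) (q (c t)) r \ T').card := by
    intro T' B hB
    refine mul_le_card_biUnion_branchBall (d := d) ?_ ?_ hB
    · intro u w hw
      have := hdlip u w 1 (.single (hcut _ _ hw)) (hall u)
      omega
    · intro s t hst ht
      rw [hdc t ht, hdc s (by omega)]
      have := hgap s t hst ht
      omega
  set U := (Finset.range m).biUnion fun t => branchBall (cutNbrs G p k) (q (c t)) r \ T with hU
  have hmemU : ∀ w ∈ U, ∃ t < m, w ∈ branchBall (cutNbrs G p k) (q (c t)) r ∧ w ∉ T := by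
    intro w hw
    simpa [hU, Finset.mem_biUnion] using hw
  have hUfar : ∀ w ∈ U, r + 1 < distTo G.Adj H w := fun w hw =>
    let ⟨t, ht, h1, h2⟩ := hmemU w hw
    hfar t ht w h1 h2
  have hUnear : ∀ w ∈ U, ∃ j ≤ l, ∃ n ≤ r + 1, Steps G.Adj n w (q j) := by
    intro w hw
    obtain ⟨t, ht, h1, -⟩ := hmemU w hw
    obtain ⟨n, hn, hs⟩ := hball t ht w h1
    exact ⟨c t, (hS _ (hcS t ht).1).2.1.le, n, hn, hcutG (CutAdj.steps_symm hs)⟩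
  rcases Nat.eq_zero_or_pos r with rfl | hr
  · have hU1 : m * (1 + (x + 3) * geoSum x 0) ≤ U.card + 1 := by
      refine (hcard ∅ _ fun t ht => ?_).trans ((Finset.card_le_card (t := insert (p 1) U) ?_).trans
        (Finset.card_insert_le _ _))
      · rw [Finset.sdiff_empty]
        exact card_branchBall (fun u w hw => (hcut u w hw).1.1) (h.card_cutNbrs hδ) hg
          (card_cutNbrs_of_notMem hδ (hS _ (hcS t ht).1).2.2)
      · intro w hw
        simp only [Finset.mem_biUnion, Finset.mem_range, Finset.sdiff_empty] at hw
        obtain ⟨t, ht, hw⟩ := hw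
        by_cases hwT : w ∈ T
        · rw [hT, Finset.mem_filter, zero_add, Nat.lt_one_iff, hG.dist_eq_zero_iff] at hwT
          rw [hwT.2]
          exact Finset.mem_insert_self _ _
        · refine Finset.mem_insert_of_mem (Finset.mem_biUnion.2 ⟨t, Finset.mem_range.2 ht, ?_⟩)
          exact Finset.mem_sdiff.2 ⟨hw, hwT⟩
    by_cases hmS : m * g < S.card
    · obtain ⟨b, hb, hcb⟩ := hlast hmS
      have hbl := (hS b hb).2.1
      have hlU : q l ∉ U := by
        intro hmem
        obtain ⟨t, ht, h1, -⟩ := hmemU _ hmem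
        obtain ⟨n, hn, hs⟩ := hball t ht _ h1
        have h2 := (hdlip _ _ _ hs (hall _)).2
        rw [hdc t ht] at h2
        have h3 : d (q l) = l := hq.dist l le_rfl
        have := hcb t ht
        omega
      have hUc := Finset.card_insert_of_notMem hlU
      refine ⟨insert (q l) U, ?_, ?_, by omega, fun _ => by omega⟩
      · intro w hw
        rcases Finset.mem_insert.1 hw with rfl | hw
        · rw [hq.last, h.dist k le_rfl]
          exact hk
        · exact hUfar w hw
      · intro w hw
        rcases Finset.mem_insert.1 hw with rfl | hw
        · exact ⟨l, le_rfl, 0, Nat.zero_le _, rfl⟩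
        · exact hUnear w hw
    · exact ⟨U, hUfar, hUnear, hU1, fun h => by omega⟩
  · have hpc := h.pathCut hG (by omega) hδ (show 2 ≤ r + 1 by omega) hg
    have hU1 := hcard T _ fun t ht => hpc.card_branchBall_sdiff (T := T)
      (fun y => by simp [hT]) (by omega) (c := q (c t)) (by
        simp only [Finset.mem_image, Finset.mem_range, Nat.lt_succ_iff, not_exists, not_and]
        exact fun i hi he => (hS _ (hcS t ht).1).2.2 i hi he.symm)
    rw [Nat.add_sub_cancel] at hU1
    exact ⟨U, hUfar, hUnear, hU1.trans (Nat.le_succ _), fun _ => hU1⟩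

end Gain

section Core

variable {V : Type*} {G : SimpleGraph V} {H : Finset V} {A : V → V → Prop} {p q : ℕ → V}
  {k l x ρ g L : ℕ}

lemma IsEscape.exists_of_le {u : V} (hr : Reaches G.Adj H u) (hk : k ≤ distTo G.Adj H u) :
    ∃ p, IsEscape G H p k := by
  obtain ⟨q, h0, -, hadj, hd⟩ := hr.exists_geodesic
  exact ⟨q, h0, fun i hi => hadj i (by omega), fun i hi => hd i (by omega)⟩

/-- Adding a path and a way back preserves strong connectivity. -/
lemma IsReturn.strong_addArcs [DecidableEq V] (hq : IsReturn G H p k q l) (h : IsEscape G H p k)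
    (hs : ∀ a ∈ H, ∀ b ∈ H, ∃ n, Steps A n a b) :
    ∀ a ∈ H ∪ (Finset.Icc 1 k).image p ∪ (Finset.Ioc 0 l).image q,
      ∀ b ∈ H ∪ (Finset.Icc 1 k).image p ∪ (Finset.Ioc 0 l).image q,
        ∃ n, Steps (addArcs A p k q 0 l) n a b := by
  have hto : ∀ a ∈ H ∪ (Finset.Icc 1 k).image p ∪ (Finset.Ioc 0 l).image q,
      (∃ z ∈ H, ∃ n, Steps (addArcs A p k q 0 l) n a z) ∧
        ∃ z ∈ H, ∃ n, Steps (addArcs A p k q 0 l) n z a := by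
    intro a ha
    have hret : ∀ i ≤ l, Steps (addArcs A p k q 0 l) (i - 0) (q i) (q 0) := fun i hi =>
      steps_addArcs_return le_rfl (Nat.zero_le i) hi
    have hout : ∀ i ≤ k, Steps (addArcs A p k q 0 l) (i - 0) (p 0) (p i) := fun i hi =>
      steps_addArcs_path (Nat.zero_le i) hi
    simp only [Finset.mem_union, Finset.mem_image, Finset.mem_Icc, Finset.mem_Ioc] at ha
    rcases ha with (ha | ⟨i, ⟨-, hi⟩, rfl⟩) | ⟨i, ⟨-, hi⟩, rfl⟩
    · exact ⟨⟨a, ha, 0, rfl⟩, a, ha, 0, rfl⟩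
    · have hl := hret l le_rfl
      rw [hq.last] at hl
      exact ⟨⟨q 0, hq.mem, _, (steps_addArcs_path hi le_rfl).trans hl⟩, p 0, h.mem, _, hout i hi⟩
    · have hl : Steps (addArcs A p k q 0 l) (l - i) (q l) (q i) :=
        steps_addArcs_return (Nat.zero_le i) hi le_rfl
      rw [hq.last] at hl
      exact ⟨⟨q 0, hq.mem, _, hret i hi⟩, p 0, h.mem, _, (hout k le_rfl).trans hl⟩
  intro a ha b hb
  obtain ⟨⟨y, hy, n1, h1⟩, -⟩ := hto a ha
  obtain ⟨-, z, hz, n2, h2⟩ := hto b hb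
  obtain ⟨n, hn⟩ := hs y hy z hz
  exact ⟨_, (h1.trans (hn.mono fun _ _ h => .inl h)).trans h2⟩

variable [Fintype V]

/-- The vertices at distance at most `ρ` from `H`. -/
noncomputable def near (G : SimpleGraph V) (H : Finset V) (ρ : ℕ) : Finset V :=
  {w | distTo G.Adj H w ≤ ρ}

/-- A strongly oriented vertex set `H` that is small compared to its `ρ`-neighbourhood. -/
structure IsCore (G : SimpleGraph V) (ρ : ℕ) (h C : ℝ) (H : Finset V) (A : V → V → Prop) :
    Prop where
  nonempty : H.Nonempty
  isPartialOrientation : IsPartialOrientation G A H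
  strong : ∀ a ∈ H, ∀ b ∈ H, ∃ n, Steps A n a b
  card_le : ((H.card : ℝ) - 1) * h ≤ C * (near G H ρ).card

variable [DecidableEq V] [DecidableRel G.Adj]

/-- The gain in the neighbourhood pays for the vertices of a path and a way back. -/
lemma IsReturn.exists_gain_ge (hq : IsReturn G H p (L * g) q l) (h : IsEscape G H p (L * g))
    (hG : G.Connected) (hx : 1 ≤ x) (hδ : x + 3 ≤ G.minDegree) (hρ : 1 ≤ ρ) (hρg : 2 * ρ < g)
    (hg : ((2 * ρ : ℕ) : ℕ∞) < G.egirth) {ε : ℝ} (hε : 0 < ε) (hL : 1 ≤ L)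
    (hLε : (g : ℝ) - 1 ≤ ε * L) {S : Finset ℕ}
    (hS : ∀ a ∈ S, 1 ≤ a ∧ a < l ∧ ∀ i ≤ L * g, q a ≠ p i) :
    ∃ U : Finset V, (∀ w ∈ U, ρ < distTo G.Adj H w) ∧
      (∀ w ∈ U, ∃ m ≤ ρ, (∃ i ≤ L * g, Steps G.Adj m w (p i)) ∨
        ∃ j ≤ l, Steps G.Adj m w (q j)) ∧
      ((L * g + S.card : ℕ) : ℝ) * (1 + (x + 3) * geoSum x (ρ - 1) : ℕ) ≤
        (2 * g + ε) * U.card := by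
  have hg3 : 3 ≤ g := by omega
  set B := 1 + (x + 3) * geoSum x (ρ - 1) with hB
  have hB5 : 5 ≤ B := by
    have := Nat.mul_le_mul (show 4 ≤ x + 3 by omega) (one_le_geoSum x (ρ - 1))
    omega
  have hg3' : (3 : ℝ) ≤ g := by exact_mod_cast hg3
  have hB5' : (5 : ℝ) ≤ B := by exact_mod_cast hB5
  have hL' : (1 : ℝ) ≤ L := by exact_mod_cast hL
  by_cases hSL : S.card < L * g
  · obtain ⟨U, hU1, hU2, hU3⟩ := h.exists_gain hG hδ hρ hρg hg
    refine ⟨U, hU1, fun w hw => ?_, ?_⟩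
    · obtain ⟨i, hi, m, hm, hs⟩ := hU2 w hw
      exact ⟨m, hm, .inl ⟨i, hi, hs⟩⟩
    · have h1 : ((L * g + S.card : ℕ) : ℝ) ≤ 2 * g * L := by
        have : L * g + S.card ≤ 2 * g * L := by nlinarith
        exact_mod_cast this
      have h2 : (L : ℝ) * B ≤ U.card := by exact_mod_cast hU3
      have h3 : 2 * g * ((L : ℝ) * B) ≤ 2 * g * U.card := by gcongr
      have h4 : ((L * g + S.card : ℕ) : ℝ) * B ≤ 2 * g * L * B := by gcongr
      have h5 : 0 ≤ ε * U.card := by positivity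
      linarith
  · have hgL : g ≤ L * g := Nat.le_mul_of_pos_left g hL
    obtain ⟨U, hU1, hU2, hU3, hU4⟩ := hq.exists_gain h hG hδ hρ hρg (by omega) hg hS
      (Nat.div_mul_le_self S.card g)
    set m := S.card / g with hm
    have hmL : L ≤ m := by
      rw [hm, Nat.le_div_iff_mul_le (by omega)]
      omega
    have hmL' : (L : ℝ) ≤ m := by exact_mod_cast hmL
    have hmε : (g : ℝ) - 1 ≤ ε * m := hLε.trans (by gcongr)
    have hLg : (L : ℝ) * g ≤ m * g := by gcongr
    have hmod : S.card = m * g + S.card % g := by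
      rw [hm, Nat.div_add_mod']
    have hlt := Nat.mod_lt S.card (show g > 0 by omega)
    refine ⟨U, hU1, fun w hw => ?_, ?_⟩
    · obtain ⟨j, hj, n, hn, hs⟩ := hU2 w hw
      exact ⟨n, hn, .inr ⟨j, hj, hs⟩⟩
    · by_cases hc : 2 ≤ ρ ∨ m * g < S.card
      · have h1 : ((L * g + S.card : ℕ) : ℝ) ≤ (2 * g + ε) * m := by
          have h2 : (S.card : ℝ) ≤ m * g + (g - 1) := by
            have : S.card + 1 ≤ m * g + g := by omega
            have : (S.card : ℝ) + 1 ≤ m * g + g := by exact_mod_cast this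
            linarith
          push_cast
          linarith
        have h2 : (m : ℝ) * B ≤ U.card := by exact_mod_cast hU4 hc
        calc ((L * g + S.card : ℕ) : ℝ) * B ≤ (2 * g + ε) * m * B := by gcongr
          _ = (2 * g + ε) * (m * B) := by ring
          _ ≤ _ := by gcongr
      · have hSc : S.card = m * g := by omega
        have h1 : (m : ℝ) * B - 1 ≤ U.card := by
          have : (m : ℝ) * B ≤ U.card + 1 := by exact_mod_cast hU3
          linarith
        have hm1 : (1 : ℝ) ≤ m := hL'.trans hmL'
        have h2 : 4 * (m : ℝ) ≤ m * B - 1 := by nlinarith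
        have h3 : ε * (4 * m) ≤ ε * (m * B - 1) := by gcongr
        have h4 : ((L * g + S.card : ℕ) : ℝ) ≤ 2 * (m * g) := by
          rw [hSc]
          push_cast
          linarith
        calc ((L * g + S.card : ℕ) : ℝ) * B ≤ 2 * (m * g) * B := by gcongr
          _ ≤ (2 * g + ε) * (m * B - 1) := by nlinarith
          _ ≤ _ := by gcongr

/-- As long as some vertex is far from a core, the core can be enlarged. -/
lemma IsCore.exists_larger {ε : ℝ}
    (hc : IsCore G ρ (1 + (x + 3) * geoSum x (ρ - 1) : ℕ) (2 * g + ε) H A)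
    (hG : Bridgeless G) (hx : 1 ≤ x) (hδ : x + 3 ≤ G.minDegree) (hρ : 1 ≤ ρ) (hρg : 2 * ρ < g)
    (hg : ((2 * ρ : ℕ) : ℕ∞) < G.egirth) (hε : 0 < ε) (hL : 1 ≤ L)
    (hLε : (g : ℝ) - 1 ≤ ε * L) {u : V} (hu : L * g ≤ distTo G.Adj H u) :
    ∃ H' A', IsCore G ρ (1 + (x + 3) * geoSum x (ρ - 1) : ℕ) (2 * g + ε) H' A' ∧
      H.card < H'.card := by
  have hreach := hG.1.reaches hc.nonempty
  obtain ⟨p, h⟩ := IsEscape.exists_of_le (hreach u) hu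
  obtain ⟨q, l, hq⟩ := h.exists_return hG
  have hk : 1 ≤ L * g := Nat.mul_pos hL (by omega)
  have hl := hq.pos h hk
  set S := (Finset.Ioo 0 l).filter fun j => ∀ i ≤ L * g, q j ≠ p i with hSdef
  have hS : ∀ a ∈ S, 1 ≤ a ∧ a < l ∧ ∀ i ≤ L * g, q a ≠ p i := by
    intro a ha
    rw [hSdef, Finset.mem_filter, Finset.mem_Ioo] at ha
    exact ⟨ha.1.1, ha.1.2, ha.2⟩
  obtain ⟨U, hU1, hU2, hU3⟩ := hq.exists_gain_ge h hG.1 hx hδ hρ hρg hg hε hL hLε hS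
  set H' := H ∪ (Finset.Icc 1 (L * g)).image p ∪ (Finset.Ioc 0 l).image q with hH'
  have hHH' : H ⊆ H' := fun a ha => by simp [hH', ha]
  have hpH' : ∀ i ≤ L * g, p i ∈ H' := by
    intro i hi
    rcases Nat.eq_zero_or_pos i with rfl | h0
    · exact hHH' h.mem
    · exact Finset.mem_union_left _ (Finset.mem_union_right _
        (Finset.mem_image_of_mem _ (Finset.mem_Icc.2 ⟨h0, hi⟩)))
  have hqH' : ∀ i ≤ l, q i ∈ H' := by
    intro i hi
    rcases Nat.eq_zero_or_pos i with rfl | h0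
    · exact hHH' hq.mem
    · exact Finset.mem_union_right _ (Finset.mem_image_of_mem _ (Finset.mem_Ioc.2 ⟨h0, hi⟩))
  have hcard : H'.card ≤ H.card + (L * g + S.card) := by
    have hsub : H' ⊆ H ∪ (Finset.Icc 1 (L * g)).image p ∪ S.image q := by
      refine Finset.union_subset Finset.subset_union_left ?_
      intro y hy
      obtain ⟨j, hj, rfl⟩ := Finset.mem_image.1 hy
      rw [Finset.mem_Ioc] at hj
      by_cases hjP : ∃ i ≤ L * g, q j = p i
      · obtain ⟨i, hi, hji⟩ := hjP
        have hi0 : i ≠ 0 := by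
          rintro rfl
          exact hq.notMem hj.1 hj.2 (hji ▸ h.mem)
        rw [hji]
        exact Finset.mem_union_left _ (Finset.mem_union_right _
          (Finset.mem_image_of_mem _ (Finset.mem_Icc.2 ⟨by omega, hi⟩)))
      · push Not at hjP
        have hjl : j ≠ l := by
          rintro rfl
          exact hjP _ le_rfl hq.last
        refine Finset.mem_union_right _ (Finset.mem_image_of_mem _ ?_)
        rw [hSdef, Finset.mem_filter, Finset.mem_Ioo]
        exact ⟨⟨hj.1, by omega⟩, hjP⟩
    have h1 := Finset.card_le_card hsub
    have h2 := Finset.card_union_le (H ∪ (Finset.Icc 1 (L * g)).image p) (S.image q)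
    have h3 := Finset.card_union_le H ((Finset.Icc 1 (L * g)).image p)
    have h4 := Finset.card_image_le (s := Finset.Icc 1 (L * g)) (f := p)
    have h5 := Finset.card_image_le (s := S) (f := q)
    rw [Nat.card_Icc] at h4
    omega
  refine ⟨H', addArcs A p (L * g) q 0 l, ⟨hc.nonempty.mono hHH', ?_, ?_, ?_⟩, ?_⟩
  · exact hq.isPartialOrientation_addArcs h hc.isPartialOrientation h.mem
      (fun i h1 hi => h.notMem h1 hi) hq.mem fun i h1 hi => hq.notMem h1 hi
  · exact hq.strong_addArcs h hc.strong
  · have hnear : near G H ρ ∪ U ⊆ near G H' ρ := by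
      intro w hw
      simp only [near, Finset.mem_filter, Finset.mem_univ, true_and, Finset.mem_union] at hw ⊢
      rcases hw with hw | hw
      · obtain ⟨y, hy, hs⟩ := (hreach w).exists_steps
        exact (distTo_le hs (hHH' hy)).trans hw
      · obtain ⟨m, hm, ⟨i, hi, hs⟩ | ⟨j, hj, hs⟩⟩ := hU2 w hw
        · exact (distTo_le hs (hpH' i hi)).trans hm
        · exact (distTo_le hs (hqH' j hj)).trans hm
    have hdisj : Disjoint (near G H ρ) U := by
      rw [Finset.disjoint_left]
      intro w h1 h2
      simp only [near, Finset.mem_filter, Finset.mem_univ, true_and] at h1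
      exact absurd h1 (not_le.2 (hU1 w h2))
    have h1 := Finset.card_le_card hnear
    rw [Finset.card_union_of_disjoint hdisj] at h1
    have h2 : ((near G H ρ).card : ℝ) + U.card ≤ (near G H' ρ).card := by exact_mod_cast h1
    have h3 : (H'.card : ℝ) ≤ H.card + (L * g + S.card : ℕ) := by exact_mod_cast hcard
    have h4 := hc.card_le
    calc ((H'.card : ℝ) - 1) * (1 + (x + 3) * geoSum x (ρ - 1) : ℕ)
        ≤ (((H.card : ℝ) - 1) + (L * g + S.card : ℕ)) * (1 + (x + 3) * geoSum x (ρ - 1) : ℕ) := by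
          gcongr
          linarith
      _ ≤ (2 * g + ε) * ((near G H ρ).card + U.card) := by
          rw [add_mul, mul_add]
          exact add_le_add h4 hU3
      _ ≤ _ := by gcongr
  · refine Finset.card_lt_card ((Finset.ssubset_iff_of_subset hHH').2
      ⟨p (L * g), hpH' _ le_rfl, h.notMem hk le_rfl⟩)

/-- There is a core that every vertex is close to. -/
lemma exists_isCore {ε : ℝ} (hG : Bridgeless G) (hx : 1 ≤ x) (hδ : x + 3 ≤ G.minDegree)
    (hρ : 1 ≤ ρ) (hρg : 2 * ρ < g) (hg : ((2 * ρ : ℕ) : ℕ∞) < G.egirth) (hε : 0 < ε)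
    (hL : 1 ≤ L) (hLε : (g : ℝ) - 1 ≤ ε * L) :
    ∃ H A, IsCore G ρ (1 + (x + 3) * geoSum x (ρ - 1) : ℕ) (2 * g + ε) H A ∧
      ∀ u, distTo G.Adj H u ≤ L * g := by
  set Q : ℕ → Prop := fun n => ∃ H A,
    IsCore G ρ (1 + (x + 3) * geoSum x (ρ - 1) : ℕ) (2 * g + ε) H A ∧ H.card = n with hQ
  have hbound : ∀ n, Q n → n ≤ Fintype.card V := by
    rintro n ⟨H, A, -, rfl⟩
    exact H.card_le_univ
  obtain ⟨v⟩ := hG.1.nonempty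
  have h1 : Q 1 := by
    refine ⟨{v}, fun _ _ => False, ⟨⟨v, by simp⟩, ⟨by simp, by simp, by simp⟩, ?_, ?_⟩, by simp⟩
    · intro a ha b hb
      rw [Finset.mem_singleton] at ha hb
      subst ha hb
      exact ⟨0, rfl⟩
    · rw [Finset.card_singleton, Nat.cast_one, sub_self, zero_mul]
      positivity
  classical
  have hspec := Nat.findGreatest_spec (P := Q) (hbound 1 h1) h1
  obtain ⟨H, A, hc, hHc⟩ := hspec
  refine ⟨H, A, hc, fun u => ?_⟩
  by_contra hu
  obtain ⟨H', A', hc', hlt⟩ := hc.exists_larger hG hx hδ hρ hρg hg hε hL hLε (not_le.1 hu).le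
  have := Nat.le_findGreatest (P := Q) (hbound _ ⟨H', A', hc', rfl⟩) ⟨H', A', hc', rfl⟩
  omega

end Core

section Ears

variable {V : Type*} {G : SimpleGraph V} {H K : Finset V} {A B : V → V → Prop} {p q : ℕ → V}
  {j l r : ℕ}

/-- The distance to `H` along an ear of `H` with `l + 1` edges is as small as possible. -/
lemma IsReturn.distTo_eq_min (hq : IsReturn G H p 1 q l) (h : IsEscape G H p 1)
    (hG : G.Connected) (hj : j ≤ l) : distTo G.Adj H (q j) = min (l - j + 1) j := by
  have hadj : ∀ i < l, G.Adj (q (i + 1)) (q i) := fun i hi => (hq.oneWay i hi).1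
  refine le_antisymm (le_min ?_ ?_) ?_
  · have h1 : Steps G.Adj (l - j) (q j) (q l) :=
      steps_of_ascending hj fun i _ hi => (hadj i hi).symm
    rw [hq.last] at h1
    exact distTo_le (h1.snoc (h.adj 0 one_pos)) h.mem
  · exact distTo_le (n := j) (steps_of_descending (Nat.zero_le j) fun i _ hi =>
      hadj i (by omega)) hq.mem
  · obtain ⟨y, hy, hs⟩ := (hG.reaches ⟨_, h.mem⟩ (q j)).exists_steps
    rcases h.split hs hy with ⟨m, hm, z, hz, hs'⟩ | ⟨i, m, h1, hi, hm, hs'⟩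
    · have := distTo_le (hs'.mono fun _ _ h => h.1) hz
      rw [hq.dist j hj] at this
      omega
    · obtain rfl : i = 1 := by omega
      have h2 := (hq.reaches hj).distTo_le_add ((CutAdj.steps_symm hs').mono fun _ _ h => h.1)
      rw [← hq.last, hq.dist l le_rfl, hq.dist j hj] at h2
      omega

/-- An extension of the partial orientation `A` of `H` to `K` in which every vertex of `K` lies on
a short directed walk from `H` to `H`. -/
structure IsEarSystem (G : SimpleGraph V) (H : Finset V) (A : V → V → Prop) (r : ℕ)
    (K : Finset V) (B : V → V → Prop) : Prop where
  subset : H ⊆ K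
  le : ∀ x y, A x y → B x y
  isPartialOrientation : IsPartialOrientation G B K
  exists_steps : ∀ y ∈ K, ∃ a b, a + b ≤ 2 * r + 1 ∧ distTo G.Adj H y = min a b ∧
    (∃ z ∈ H, Steps B a z y) ∧ ∃ z ∈ H, Steps B b y z

namespace IsEarSystem

lemma flip (h : IsEarSystem G H A r K B) :
    IsEarSystem G H (fun x y => A y x) r K (fun x y => B y x) := by
  refine ⟨h.subset, fun x y => h.le y x, h.isPartialOrientation.flip, fun y hy => ?_⟩
  obtain ⟨a, b, hab, hd, ⟨z, hz, h1⟩, z', hz', h2⟩ := h.exists_steps y hy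
  exact ⟨b, a, by omega, by rw [hd, min_comm], ⟨z', hz', h2.flip⟩, z, hz, h1.flip⟩

lemma addArcs [DecidableEq V] (h : IsEarSystem G H A r K B) (hG : G.Connected)
    (hr : ∀ u, distTo G.Adj H u ≤ r) (hp : IsEscape G H p 1) (hpK : p 1 ∉ K)
    (hq : IsReturn G H p 1 q l) (hj : j ≤ l) (hqj : q j ∈ K)
    (hqK : ∀ i, j < i → i ≤ l → q i ∉ K) {z : V} (hz : z ∈ H) (hs : Steps B j (q j) z) :
    IsEarSystem G H A r (K ∪ (Finset.Icc 1 1).image p ∪ (Finset.Ioc j l).image q)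
      (addArcs B p 1 q j l) := by
  have hlr : l ≤ 2 * r := by
    by_contra! hlr
    have := hr (q (r + 1))
    rw [hq.distTo_eq_min hp hG (by omega)] at this
    omega
  have hjl : j < l := lt_of_le_of_ne hj fun he => hpK (by rw [← hq.last, ← he]; exact hqj)
  have hB : ∀ x y, B x y → _root_.addArcs B p 1 q j l x y := fun x y h => .inl h
  refine ⟨fun x hx => ?_, fun x y hxy => .inl (h.le x y hxy),
    hq.isPartialOrientation_addArcs hp h.isPartialOrientation (h.subset hp.mem) ?_ hqj hqK, ?_⟩
  · exact Finset.mem_union_left _ (Finset.mem_union_left _ (h.subset hx))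
  · intro i h1 h2
    rwa [le_antisymm h2 h1]
  · have key : ∀ i, j < i → i ≤ l → ∃ a b, a + b ≤ 2 * r + 1 ∧
        distTo G.Adj H (q i) = min a b ∧
        (∃ z ∈ H, Steps (_root_.addArcs B p 1 q j l) a z (q i)) ∧
        ∃ z ∈ H, Steps (_root_.addArcs B p 1 q j l) b (q i) z := by
      intro i hji hi
      have h1 : Steps (_root_.addArcs B p 1 q j l) (1 - 0) (p 0) (p 1) :=
        steps_addArcs_path zero_le_one le_rfl
      rw [← hq.last] at h1
      refine ⟨1 - 0 + (l - i), i - j + j, by omega, ?_,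
        ⟨_, hp.mem, h1.trans (steps_addArcs_return hji.le hi le_rfl)⟩,
        z, hz, (steps_addArcs_return le_rfl hji.le hi).trans (hs.mono hB)⟩
      rw [hq.distTo_eq_min hp hG hi]
      omega
    intro y hy
    simp only [Finset.mem_union, Finset.mem_image, Finset.mem_Icc, Finset.mem_Ioc] at hy
    rcases hy with (hy | ⟨i, ⟨h1, h2⟩, rfl⟩) | ⟨i, ⟨h1, h2⟩, rfl⟩
    · obtain ⟨a, b, hab, hd, ⟨z, hz, h1⟩, z', hz', h2⟩ := h.exists_steps y hy
      exact ⟨a, b, hab, hd, ⟨z, hz, h1.mono hB⟩, z', hz', h2.mono hB⟩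
    · rw [le_antisymm h2 h1, ← hq.last]
      exact key l hjl le_rfl
    · exact key i h1 h2

/-- An ear system that misses a neighbour of `H` can be enlarged. -/
lemma exists_larger [DecidableEq V] (h : IsEarSystem G H A r K B) (hG : Bridgeless G)
    (hr : ∀ u, distTo G.Adj H u ≤ r) (hp : IsEscape G H p 1) (hpK : p 1 ∉ K) :
    ∃ K' B', IsEarSystem G H A r K' B' ∧ K.card < K'.card := by
  obtain ⟨q, l, hq⟩ := hp.exists_return hG
  set j := Nat.findGreatest (fun j => q j ∈ K) l
  have hj : j ≤ l := Nat.findGreatest_le l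
  have hqj : q j ∈ K := Nat.findGreatest_spec (P := fun j => q j ∈ K) (Nat.zero_le l)
    (h.subset hq.mem)
  have hqK : ∀ i, j < i → i ≤ l → q i ∉ K := fun i h1 h2 => Nat.findGreatest_is_greatest h1 h2
  have hle : ∀ {B : V → V → Prop}, IsPartialOrientation G B K → ∀ {n z}, z ∈ H →
      Steps B n (q j) z → j ≤ n := by
    intro B hB n z hz hs
    rw [← hq.dist j hj]
    refine distTo_le (hs.mono fun x y hxy => ⟨hB.adj x y hxy, fun i hi hx => ?_⟩) hz
    obtain rfl : i = 0 := by omega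
    exact absurd (hx ▸ (hB.mem x y hxy).1) hpK
  have hlt : ∀ L : Finset V, K.card < (K ∪ (Finset.Icc 1 1).image p ∪ L).card := fun L =>
    Finset.card_lt_card (Finset.ssubset_iff_subset_ne.2
      ⟨fun x hx => Finset.mem_union_left _ (Finset.mem_union_left _ hx),
        fun he => hpK (by rw [he]; simp)⟩)
  obtain ⟨a, b, -, hd, ⟨z, hz, h1⟩, z', hz', h2⟩ := h.exists_steps _ hqj
  have ha := hle h.isPartialOrientation.flip hz h1.flip
  have hb := hle h.isPartialOrientation hz' h2
  rw [hq.distTo_eq_min hp hG.1 hj] at hd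
  rcases (by omega : b = j ∨ a = j) with rfl | rfl
  · exact ⟨_, _, h.addArcs hG.1 hr hp hpK hq hj hqj hqK hz' h2, hlt _⟩
  · exact ⟨_, _, (h.flip.addArcs hG.1 hr hp hpK hq hj hqj hqK hz h1.flip).flip, hlt _⟩

/-- Some ear system contains the whole neighbourhood of `H`. -/
lemma exists_full [Fintype V] (hG : Bridgeless G) (hA : IsPartialOrientation G A H)
    (hH : H.Nonempty) (hr : ∀ u, distTo G.Adj H u ≤ r) :
    ∃ K B, IsEarSystem G H A r K B ∧ ∀ v, distTo G.Adj H v ≤ 1 → v ∈ K := by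
  classical
  by_contra! hc
  have key : ∀ n, ∃ K B, IsEarSystem G H A r K B ∧ n ≤ K.card := by
    intro n
    induction n with
    | zero =>
      refine ⟨H, A, ⟨Finset.Subset.refl H, fun _ _ h => h, hA, fun y hy => ?_⟩, Nat.zero_le _⟩
      exact ⟨0, 0, Nat.zero_le _, distTo_eq_zero_of_mem hy, ⟨y, hy, rfl⟩, y, hy, rfl⟩
    | succ n ih =>
      obtain ⟨K, B, h, hn⟩ := ih
      obtain ⟨v, hv, hvK⟩ := hc K B h
      have hreach := hG.1.reaches hH v
      have h0 : distTo G.Adj H v ≠ 0 := fun h0 =>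
        hvK (h.subset (hreach.mem_of_distTo_eq_zero h0))
      obtain ⟨p, hp0, hpv, hadj, hd⟩ := hreach.exists_geodesic
      rw [show distTo G.Adj H v = 1 by omega] at hpv hadj hd
      obtain ⟨K', B', h', hlt⟩ := h.exists_larger hG hr ⟨hp0, hadj, hd⟩ (hpv ▸ hvK)
      exact ⟨K', B', h', by omega⟩
  obtain ⟨K, -, -, hK⟩ := key (Fintype.card V + 1)
  have := K.card_le_univ
  omega

end IsEarSystem

/-- A partial orientation of `H` extends to one in which every vertex has directed walks of
quadratic length to and from `H`. -/
lemma IsPartialOrientation.exists_extension [Fintype V] (hG : Bridgeless G)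
    (hA : IsPartialOrientation G A H) (hH : H.Nonempty) (hr : ∀ u, distTo G.Adj H u ≤ r) :
    ∃ B, (∀ x y, A x y → B x y) ∧ IsPartialOrientation G B Finset.univ ∧
      ∀ u, (∃ z ∈ H, ∃ m ≤ r * (r + 1), Steps B m u z) ∧
        ∃ z ∈ H, ∃ m ≤ r * (r + 1), Steps B m z u := by
  induction r generalizing H A with
  | zero =>
    refine ⟨A, fun _ _ h => h, ⟨hA.adj, hA.asymm, fun _ _ _ => ⟨Finset.mem_univ _,
      Finset.mem_univ _⟩⟩, fun u => ?_⟩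
    have hu := (hG.1.reaches hH u).mem_of_distTo_eq_zero (Nat.le_zero.1 (hr u))
    exact ⟨⟨u, hu, 0, le_rfl, rfl⟩, u, hu, 0, le_rfl, rfl⟩
  | succ r ih =>
    obtain ⟨K, A', hK, hfull⟩ := IsEarSystem.exists_full hG hA hH hr
    have hdist : ∀ u, distTo G.Adj K u ≤ r := by
      intro u
      obtain ⟨p, -, hpu, hadj, hd⟩ := (hG.1.reaches hH u).exists_geodesic
      have hu := hr u
      rcases Nat.eq_zero_or_pos (distTo G.Adj H u) with h0 | h0
      · rw [distTo_eq_zero_of_mem (hfull u (by omega))]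
        exact Nat.zero_le r
      · have h1 := distTo_le (steps_of_descending h0 fun i _ hi => hadj i hi)
          (hfull (p 1) (hd 1 h0).le)
        rw [hpu] at h1
        omega
    have hbound : ∀ y ∈ K, (∃ z ∈ H, ∃ m ≤ 2 * (r + 1), Steps A' m y z) ∧
        ∃ z ∈ H, ∃ m ≤ 2 * (r + 1), Steps A' m z y := by
      intro y hy
      by_cases hyH : y ∈ H
      · exact ⟨⟨y, hyH, 0, Nat.zero_le _, rfl⟩, y, hyH, 0, Nat.zero_le _, rfl⟩
      · obtain ⟨a, b, hab, hd, ⟨z, hz, h1⟩, z', hz', h2⟩ := hK.exists_steps y hy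
        have h0 : distTo G.Adj H y ≠ 0 := fun h0 =>
          hyH ((hG.1.reaches hH y).mem_of_distTo_eq_zero h0)
        exact ⟨⟨z', hz', b, by omega, h2⟩, z, hz, a, by omega, h1⟩
    obtain ⟨B, hle, hB, hsteps⟩ :=
      ih hK.isPartialOrientation (hH.mono hK.subset) hdist
    refine ⟨B, fun x y h => hle x y (hK.le x y h), hB, fun u => ?_⟩
    obtain ⟨⟨y, hy, m, hm, hs⟩, y', hy', m', hm', hs'⟩ := hsteps u
    obtain ⟨⟨z, hz, n, hn, ht⟩, -⟩ := hbound y hy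
    obtain ⟨-, z', hz', n', hn', ht'⟩ := hbound y' hy'
    have hsum : (r + 1) * (r + 1 + 1) = r * (r + 1) + 2 * (r + 1) := by ring
    exact ⟨⟨z, hz, m + n, by omega, hs.trans (ht.mono hle)⟩,
      z', hz', n' + m', by omega, (ht'.mono hle).trans hs'⟩

end Ears

open Classical in
/-- A partial orientation extends to an orientation. -/
lemma IsPartialOrientation.exists_isOrientation {V : Type*} {G : SimpleGraph V} {K : Finset V}
    {A : V → V → Prop} (hA : IsPartialOrientation G A K) :
    ∃ D, IsOrientation G D ∧ ∀ x y, A x y → D x y := by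
  let := linearOrderOfSTO (α := V) WellOrderingRel
  refine ⟨fun x y => A x y ∨ G.Adj x y ∧ ¬ A y x ∧ x < y, ⟨?_, fun u v huv => ?_⟩,
    fun _ _ h => .inl h⟩
  · rintro u v (h | h)
    exacts [hA.adj u v h, h.1]
  · have h1 := hA.asymm u v
    have h2 := huv.symm
    rcases lt_or_gt_of_ne huv.ne with h3 | h3
    · have h4 := h3.not_gt
      tauto
    · have h4 := h3.not_gt
      tauto

/-- For a bridgeless graph `G` of order `n`, minimum degree `δ ≥ 4` and
girth `g`, for every `ε > 0`, with `L = ⌈(g-1)/ε⌉`, the oriented diameter of `G` is at most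
`(2g+ε)·n/h(δ,g) + 4·C(Lg+1, 2)`. -/
theorem oriented_diameter_le_of_girth_minDegree
    {V : Type*} [Fintype V] (G : SimpleGraph V) [DecidableRel G.Adj]
    (n δ g : ℕ) (hn : Fintype.card V = n)
    (hG : Bridgeless G) (hδ : G.minDegree = δ) (hδ4 : 4 ≤ δ)
    (hg : G.egirth = (g : ℕ∞)) (ε : ℝ) (hε : 0 < ε) :
    ∃ D : V → V → Prop, IsOrientation G D ∧
      ∀ u v : V, ∃ m : ℕ,
        (m : ℝ) ≤ (2 * g + ε) * n / hPoly δ g +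
          4 * Nat.choose (⌈((g : ℝ) - 1) / ε⌉₊ * g + 1) 2 ∧
        DiReach D u v m := by
  classical
  have hg3 : 3 ≤ g := by exact_mod_cast hg ▸ G.three_le_egirth
  obtain ⟨x, rfl⟩ := Nat.exists_eq_add_of_le' (show 3 ≤ δ by omega)
  set L := ⌈((g : ℝ) - 1) / ε⌉₊
  have hgpos : (0 : ℝ) < g - 1 := by
    have : (3 : ℝ) ≤ g := by exact_mod_cast hg3
    linarith
  have hLε : (g : ℝ) - 1 ≤ ε * L := by
    rw [mul_comm, ← div_le_iff₀ hε]
    exact Nat.le_ceil _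
  have hL1 : 1 ≤ L := Nat.ceil_pos.2 (div_pos hgpos hε)
  obtain ⟨H, A, hcore, hdist⟩ := exists_isCore (ρ := (g - 1) / 2) hG (by omega : 1 ≤ x) hδ.ge
    (by omega) (by omega) (by rw [hg]; exact_mod_cast (by omega)) hε hL1 hLε
  rw [← hPoly_eq x g] at hcore
  obtain ⟨B, hAB, hB, hsteps⟩ :=
    hcore.isPartialOrientation.exists_extension hG hcore.nonempty hdist
  obtain ⟨D, hD, hBD⟩ := hB.exists_isOrientation
  refine ⟨D, hD, fun u v => ?_⟩
  obtain ⟨⟨a, ha, m₁, hm₁, hs₁⟩, -⟩ := hsteps u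
  obtain ⟨-, b, hb, m₂, hm₂, hs₂⟩ := hsteps v
  obtain ⟨k, hk⟩ := hcore.strong a ha b hb
  obtain ⟨m, hm, hs⟩ := hk.exists_lt_card hcore.isPartialOrientation.mem hb
  refine ⟨m₁ + m + m₂, ?_, (((hs₁.mono hBD).trans
    (hs.mono fun x y h => hBD x y (hAB x y h))).trans (hs₂.mono hBD)).diReach⟩
  have hh : (0 : ℝ) < hPoly (x + 3) g := by
    rw [hPoly]
    positivity
  have hmH : (m : ℝ) ≤ (2 * g + ε) * n / hPoly (x + 3) g := by
    rw [le_div_iff₀ hh]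
    have h1 : (m : ℝ) + 1 ≤ H.card := by exact_mod_cast hm
    have h2 : ((near G H ((g - 1) / 2)).card : ℝ) ≤ n := by
      rw [← hn]
      exact_mod_cast Finset.card_le_univ _
    calc (m : ℝ) * hPoly (x + 3) g ≤ (H.card - 1) * hPoly (x + 3) g := by
          gcongr
          linarith
      _ ≤ _ := hcore.card_le
      _ ≤ _ := by gcongr
  have hchoose : 4 * Nat.choose (L * g + 1) 2 = 2 * (L * g * (L * g + 1)) := by
    have := Nat.triangle_succ (L * g)
    have h2 := Nat.div_mul_cancel (Nat.even_mul_succ_self (L * g)).two_dvd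
    rw [Nat.choose_two_right, Nat.add_sub_cancel, mul_comm (L * g + 1)]
    omega
  have hsum : ((m₁ + m₂ : ℕ) : ℝ) ≤ ((4 * Nat.choose (L * g + 1) 2 : ℕ) : ℝ) := by
    exact_mod_cast (by omega)
  push_cast at hsum ⊢
  linarith
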